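/- There is a constant C depending only on N and M such that for every u ∈ P₁(0,M) and every ε > 0: (i) the Lebesgue measure of {x ∈ Ω ∩ B(0,1/2) : |∇u(x)| < ε} is at most C·ε; (ii) the Lebesgue measure of {x ∈ B(0,1/2) : dist(x,∂Ω) < ε} is at most C·ε; and (iii) the (N−1)-dimensional Hausdorff measure of ∂Ω ∩ B(0,1/2) is at most C. -/

import Mathlib

open MeasureTheory Metric Set Filter
open scoped RealInnerProductSpace

noncomputable section

/-- The Laplacian of `φ` at `x`, as the sum of the pure second derivatives. -/
def lap (N : ℕ) (φ : EuclideanSpace ℝ (Fin N) → ℝ) (x : EuclideanSpace ℝ (Fin N)) : ℝ :=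
  ∑ i : Fin N,
    fderiv ℝ (fun y => fderiv ℝ φ y (EuclideanSpace.single i 1)) x (EuclideanSpace.single i 1)

/-- Membership in the class `P_r(z, M)`. -/
def MemP (N : ℕ) (r : ℝ) (z : EuclideanSpace ℝ (Fin N)) (M : ℝ)
    (Ω : Set (EuclideanSpace ℝ (Fin N))) (u : EuclideanSpace ℝ (Fin N) → ℝ) : Prop :=
  IsOpen Ω ∧ ContDiff ℝ 1 u ∧
    (∀ φ : EuclideanSpace ℝ (Fin N) → ℝ, ContDiff ℝ (⊤ : ℕ∞) φ → tsupport φ ⊆ ball z r →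
      ∫ x, u x * lap N φ x = ∫ x in Ω, φ x) ∧
    (∀ x ∈ ball z r \ Ω, u x = 0 ∧ gradient u x = 0) ∧
    (∀ x ∈ ball z r, |u x| ≤ M) ∧
    z ∈ frontier Ω

/-- Membership in the class `P_∞(0, M)` of global solutions with quadratic growth. -/
def MemPinf (N : ℕ) (M : ℝ) (Ω : Set (EuclideanSpace ℝ (Fin N)))
    (u : EuclideanSpace ℝ (Fin N) → ℝ) : Prop :=
  IsOpen Ω ∧ ContDiff ℝ 1 u ∧
    (∀ φ : EuclideanSpace ℝ (Fin N) → ℝ, ContDiff ℝ (⊤ : ℕ∞) φ → HasCompactSupport φ →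
      ∫ x, u x * lap N φ x = ∫ x in Ω, φ x) ∧
    (∀ x ∈ Ωᶜ, u x = 0 ∧ gradient u x = 0) ∧
    (0 : EuclideanSpace ℝ (Fin N)) ∈ frontier Ω ∧
    (∀ x, |u x| ≤ M * (‖x‖ ^ 2 + 1))

/-- The minimum diameter of a set: the smallest width of a slab containing it. -/
def MD (N : ℕ) (D : Set (EuclideanSpace ℝ (Fin N))) : ℝ :=
  ⨅ e : {e : EuclideanSpace ℝ (Fin N) // ‖e‖ = 1},
    ((⨆ x : D, ⟪(x : EuclideanSpace ℝ (Fin N)), (e : EuclideanSpace ℝ (Fin N))⟫) -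
      ⨅ x : D, ⟪(x : EuclideanSpace ℝ (Fin N)), (e : EuclideanSpace ℝ (Fin N))⟫)

/-- The density function `δ_r(u)`. -/
def deltaFn (N : ℕ) (u : EuclideanSpace ℝ (Fin N) → ℝ) (r : ℝ) : ℝ :=
  MD N ({x | u x = 0 ∧ gradient u x = 0} ∩ ball 0 r) / r

/-- Half-space solutions `x ↦ (max(⟪x,e⟫,0))²/2`. -/
def IsHalfSpaceSol (N : ℕ) (u : EuclideanSpace ℝ (Fin N) → ℝ) : Prop :=
  ∃ e : EuclideanSpace ℝ (Fin N), ‖e‖ = 1 ∧ ∀ x, u x = (max ⟪x, e⟫ 0) ^ 2 / 2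

/-- `∂Ω ∩ B` is the graph of a `C¹` function. -/
def IsC1Graph (N : ℕ) (Ω B : Set (EuclideanSpace ℝ (Fin N))) : Prop :=
  ∃ (e : EuclideanSpace ℝ (Fin N)) (f : EuclideanSpace ℝ (Fin N) → ℝ),
    ‖e‖ = 1 ∧ ContDiff ℝ 1 f ∧
    Ω ∩ B = {x ∈ B | f (x - ⟪x, e⟫ • e) < ⟪x, e⟫} ∧
    frontier Ω ∩ B = {x ∈ B | ⟪x, e⟫ = f (x - ⟪x, e⟫ • e)}

/-- `∂Ω ∩ B` is the graph of a real-analytic function. -/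
def IsAnalyticGraph (N : ℕ) (Ω B : Set (EuclideanSpace ℝ (Fin N))) : Prop :=
  ∃ (e : EuclideanSpace ℝ (Fin N)) (f : EuclideanSpace ℝ (Fin N) → ℝ),
    ‖e‖ = 1 ∧ (∀ x, AnalyticAt ℝ f x) ∧
    Ω ∩ B = {x ∈ B | f (x - ⟪x, e⟫ • e) < ⟪x, e⟫} ∧
    frontier Ω ∩ B = {x ∈ B | ⟪x, e⟫ = f (x - ⟪x, e⟫ • e)}

/-- The Alt–Caffarelli–Friedman functional `φ(r, v)` centered at the origin. -/
def acf (N : ℕ) (v : EuclideanSpace ℝ (Fin N) → ℝ) (r : ℝ) : ℝ :=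
  r ^ (-4 : ℤ) *
    (∫ x in ball (0 : EuclideanSpace ℝ (Fin N)) r,
      ‖gradient (fun y => max (v y) 0) x‖ ^ 2 * ‖x‖ ^ ((2 : ℤ) - (N : ℤ))) *
    ∫ x in ball (0 : EuclideanSpace ℝ (Fin N)) r,
      ‖gradient (fun y => max (-v y) 0) x‖ ^ 2 * ‖x‖ ^ ((2 : ℤ) - (N : ℤ))

/-- `S_j(z, u) = sup_{B(z, 2^{-j})} |u|`. -/
def Sj (N : ℕ) (z : EuclideanSpace ℝ (Fin N)) (u : EuclideanSpace ℝ (Fin N) → ℝ) (j : ℕ) : ℝ :=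
  sSup ((fun x => |u x|) '' ball z ((2 : ℝ) ^ (-(j : ℤ))))

open scoped Topology ContDiff

section Kernels

variable {N : ℕ}

local notation "𝔼" => EuclideanSpace ℝ (Fin N)

/-- The derivative of `κ` in the direction `v`. -/
def dirDeriv (v : 𝔼) (κ : 𝔼 → ℝ) (y : 𝔼) : ℝ := fderiv ℝ κ y v

theorem contDiff_dirDeriv {κ : 𝔼 → ℝ} (h : ContDiff ℝ ∞ κ) (v : 𝔼) :
    ContDiff ℝ ∞ (dirDeriv v κ) :=
  (h.fderiv_right (m := ∞) (by simp)).clm_apply contDiff_const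

theorem tsupport_dirDeriv_subset (κ : 𝔼 → ℝ) (v : 𝔼) :
    tsupport (dirDeriv v κ) ⊆ tsupport κ := by
  refine closure_minimal (fun x hx => ?_) (isClosed_tsupport κ)
  refine support_fderiv_subset ℝ (f := κ) ?_
  simp only [Function.mem_support, dirDeriv] at hx ⊢
  intro h
  simp [h] at hx

theorem dirDeriv_comm {κ : 𝔼 → ℝ} (h : ContDiff ℝ ∞ κ) (v w : 𝔼) :
    dirDeriv v (dirDeriv w κ) = dirDeriv w (dirDeriv v κ) := by
  funext x
  have hd : DifferentiableAt ℝ (fderiv ℝ κ) x :=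
    ((h.fderiv_right (m := ∞) (by simp)).differentiable (by simp)) x
  have key : ∀ a b : 𝔼, dirDeriv a (dirDeriv b κ) x = fderiv ℝ (fderiv ℝ κ) x a b := by
    intro a b
    have e : dirDeriv b κ = fun y => fderiv ℝ κ y b := rfl
    rw [e, dirDeriv, fderiv_clm_apply hd (differentiableAt_const b)]
    simp
  rw [key, key]
  have hs : IsSymmSndFDerivAt ℝ κ x := by
    apply (h.contDiffAt).isSymmSndFDerivAt
    simpa using WithTop.coe_le_coe.2 (le_top : (2 : ℕ∞) ≤ ⊤)
  exact hs v w

theorem lap_eq_sum (φ : 𝔼 → ℝ) (x : 𝔼) :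
    lap N φ x = ∑ i : Fin N, dirDeriv (EuclideanSpace.single i 1)
      (dirDeriv (EuclideanSpace.single i 1) φ) x := rfl

theorem lap_dirDeriv {κ : 𝔼 → ℝ} (h : ContDiff ℝ ∞ κ) (v : 𝔼) (x : 𝔼) :
    lap N (dirDeriv v κ) x = dirDeriv v (lap N κ) x := by
  have h1 : lap N κ = fun x => ∑ i : Fin N, dirDeriv (EuclideanSpace.single i 1)
      (dirDeriv (EuclideanSpace.single i 1) κ) x := rfl
  rw [lap_eq_sum, h1, dirDeriv, fderiv_fun_sum]
  · simp only [_root_.sum_apply]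
    refine Finset.sum_congr rfl fun i _ => ?_
    rw [dirDeriv_comm h _ v, dirDeriv_comm (contDiff_dirDeriv h _) _ v]
    rfl
  · intro i _
    exact (contDiff_dirDeriv (contDiff_dirDeriv h _) _).differentiable (by simp) x

theorem contDiff_lap {κ : 𝔼 → ℝ} (h : ContDiff ℝ ∞ κ) : ContDiff ℝ ∞ (lap N κ) :=
  ContDiff.sum fun _ _ => contDiff_dirDeriv (contDiff_dirDeriv h _) _

/-- Two bump functions on the unit ball for which `t ^ (1 - a) • ϑ (· / t)` has Laplacian
the `t`-derivative of `t ^ (-a) • κ (· / t)`. -/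
structure KernelPair (a : ℕ) (κ ϑ : 𝔼 → ℝ) : Prop where
  contDiff_left : ContDiff ℝ ∞ κ
  contDiff_right : ContDiff ℝ ∞ ϑ
  tsupport_left : tsupport κ ⊆ closedBall 0 1
  tsupport_right : tsupport ϑ ⊆ closedBall 0 1
  euler : ∀ y, a * κ y + fderiv ℝ κ y y = -lap N ϑ y

theorem KernelPair.dirDeriv {a : ℕ} {κ ϑ : 𝔼 → ℝ} (h : KernelPair a κ ϑ) (v : 𝔼) :
    KernelPair (a + 1) (dirDeriv v κ) (dirDeriv v ϑ) where
  contDiff_left := contDiff_dirDeriv h.contDiff_left v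
  contDiff_right := contDiff_dirDeriv h.contDiff_right v
  tsupport_left := (tsupport_dirDeriv_subset κ v).trans h.tsupport_left
  tsupport_right := (tsupport_dirDeriv_subset ϑ v).trans h.tsupport_right
  euler := by
    intro y
    have hκ := h.contDiff_left
    have hd : DifferentiableAt ℝ κ y := hκ.differentiable (by simp) y
    have hd2 : DifferentiableAt ℝ (fderiv ℝ κ) y :=
      ((hκ.fderiv_right (m := ∞) (by simp)).differentiable (by simp)) y
    rw [lap_dirDeriv h.contDiff_right]
    have e1 : (fun y => -lap N ϑ y) = fun y => a * κ y + fderiv ℝ κ y y := by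
      funext y; rw [h.euler y]
    have e2 : -_root_.dirDeriv v (lap N ϑ) y = _root_.dirDeriv v (fun y => -lap N ϑ y) y := by
      simp only [_root_.dirDeriv]
      rw [fderiv_fun_neg]; rfl
    rw [e2, e1]
    simp only [_root_.dirDeriv]
    rw [fderiv_fun_add (hd.const_mul _) (hd2.clm_apply differentiableAt_fun_id),
      fderiv_const_mul hd, fderiv_clm_apply hd2 differentiableAt_fun_id]
    have hs : IsSymmSndFDerivAt ℝ κ y := by
      apply (hκ.contDiffAt).isSymmSndFDerivAt
      simpa using WithTop.coe_le_coe.2 (le_top : (2 : ℕ∞) ≤ ⊤)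
    have e3 : fderiv ℝ (_root_.dirDeriv v κ) y y = fderiv ℝ (fderiv ℝ κ) y v y := by
      have e : _root_.dirDeriv v κ = fun y => fderiv ℝ κ y v := rfl
      rw [e, fderiv_clm_apply hd2 (differentiableAt_const v)]
      simp [hs y v]
    rw [e3]
    simp
    ring

/-- The potential kernel, a radial bump function. -/
def thetaKernel (N : ℕ) (y : EuclideanSpace ℝ (Fin N)) : ℝ := expNegInvGlue (1 - ‖y‖ ^ 2)

/-- The (unnormalised) averaging kernel. -/
def rhoKernel (N : ℕ) (y : EuclideanSpace ℝ (Fin N)) : ℝ :=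
  2 * deriv expNegInvGlue (1 - ‖y‖ ^ 2)

theorem thetaKernel_nonneg (y : 𝔼) : 0 ≤ thetaKernel N y := expNegInvGlue.nonneg _

theorem thetaKernel_pos {y : 𝔼} (hy : ‖y‖ < 1) : 0 < thetaKernel N y := by
  apply expNegInvGlue.pos_of_pos
  nlinarith [norm_nonneg y]

theorem rhoKernel_nonneg (y : 𝔼) : 0 ≤ rhoKernel N y :=
  mul_nonneg zero_le_two expNegInvGlue.monotone.deriv_nonneg

theorem contDiff_thetaKernel : ContDiff ℝ ∞ (thetaKernel N) :=
  expNegInvGlue.contDiff.comp (contDiff_const.sub (contDiff_norm_sq ℝ))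

theorem contDiff_rhoKernel : ContDiff ℝ ∞ (rhoKernel N) := by
  have h : ContDiff ℝ ∞ (deriv expNegInvGlue) :=
    (contDiff_infty_iff_deriv.1 (expNegInvGlue.contDiff (n := ⊤))).2
  exact contDiff_const.mul (h.comp (contDiff_const.sub (contDiff_norm_sq ℝ)))

theorem dirDeriv_thetaKernel (v y : 𝔼) :
    dirDeriv v (thetaKernel N) y = -(rhoKernel N y * ⟪y, v⟫) := by
  have h1 : HasFDerivAt (fun y : 𝔼 => 1 - ‖y‖ ^ 2) (-(2 • (innerSL ℝ y))) y := by
    simpa using (hasStrictFDerivAt_norm_sq y).hasFDerivAt.const_sub 1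
  have h2 : HasDerivAt expNegInvGlue (deriv expNegInvGlue (1 - ‖y‖ ^ 2)) (1 - ‖y‖ ^ 2) :=
    ((expNegInvGlue.contDiff (n := ⊤)).differentiable (by simp) _).hasDerivAt
  have h3 := h2.comp_hasFDerivAt y h1
  have h4 : HasFDerivAt (thetaKernel N) _ y := h3
  rw [dirDeriv, h4.fderiv]
  simp [rhoKernel]
  ring

theorem tsupport_thetaKernel : tsupport (thetaKernel N) ⊆ closedBall 0 1 := by
  refine closure_minimal (fun x hx => ?_) isClosed_closedBall
  by_contra h
  apply hx
  apply expNegInvGlue.zero_of_nonpos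
  simp at h
  nlinarith

theorem tsupport_rhoKernel : tsupport (rhoKernel N) ⊆ closedBall 0 1 := by
  refine closure_minimal (fun x hx => ?_) isClosed_closedBall
  by_contra h
  apply hx
  have h1 : 1 - ‖x‖ ^ 2 < 0 := by
    simp at h
    nlinarith
  have : expNegInvGlue =ᶠ[𝓝 (1 - ‖x‖ ^ 2)] fun _ => 0 := by
    filter_upwards [gt_mem_nhds h1] with t ht
    exact expNegInvGlue.zero_of_nonpos ht.le
  simp [rhoKernel, this.deriv_eq]

theorem kernelPair_rho_theta : KernelPair N (rhoKernel N) (thetaKernel N) where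
  contDiff_left := contDiff_rhoKernel
  contDiff_right := contDiff_thetaKernel
  tsupport_left := tsupport_rhoKernel
  tsupport_right := tsupport_thetaKernel
  euler := by
    intro y
    have hd : DifferentiableAt ℝ (rhoKernel N) y := contDiff_rhoKernel.differentiable (by simp) y
    have h1 : ∀ i : Fin N, dirDeriv (EuclideanSpace.single i 1)
        (dirDeriv (EuclideanSpace.single i 1) (thetaKernel N)) y =
        -(rhoKernel N y + y i * fderiv ℝ (rhoKernel N) y (EuclideanSpace.single i 1)) := by
      intro i
      have : dirDeriv (EuclideanSpace.single i 1) (thetaKernel N) =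
          fun y => -(rhoKernel N y * (EuclideanSpace.proj i : 𝔼 →L[ℝ] ℝ) y) := by
        funext y
        rw [dirDeriv_thetaKernel]
        simp [EuclideanSpace.inner_single_right]
      rw [this, dirDeriv, fderiv_fun_neg, fderiv_fun_mul hd (by fun_prop), ContinuousLinearMap.fderiv]
      simp
    rw [lap_eq_sum, Finset.sum_congr rfl fun i _ => h1 i]
    have h2 : fderiv ℝ (rhoKernel N) y y =
        ∑ i, y i * fderiv ℝ (rhoKernel N) y (EuclideanSpace.single i 1) := by
      conv_lhs => arg 2; rw [← (EuclideanSpace.basisFun (Fin N) ℝ).sum_repr y]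
      simp only [map_sum, map_smul, smul_eq_mul, EuclideanSpace.basisFun_apply,
        EuclideanSpace.basisFun_repr]
    rw [h2]
    simp [Finset.sum_add_distrib]

theorem integral_rhoKernel_pos (hN : 0 < N) : 0 < ∫ y, rhoKernel N y := by
  have hc : HasCompactSupport (rhoKernel N) := (isCompact_closedBall 0 1).of_isClosed_subset
    (isClosed_tsupport _) tsupport_rhoKernel
  have hdiff : Differentiable ℝ expNegInvGlue :=
    (expNegInvGlue.contDiff (n := ⊤)).differentiable (by simp)
  obtain ⟨s, hs, hs'⟩ := exists_deriv_eq_slope expNegInvGlue zero_lt_one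
    hdiff.continuous.continuousOn hdiff.differentiableOn
  have hpos : 0 < deriv expNegInvGlue s := by
    rw [hs', expNegInvGlue.zero]
    have := expNegInvGlue.pos_of_pos zero_lt_one
    simpa using this
  refine contDiff_rhoKernel.continuous.integral_pos_of_hasCompactSupport_nonneg_nonzero hc
    rhoKernel_nonneg (x := EuclideanSpace.single ⟨0, hN⟩ (√(1 - s))) ?_
  have : 1 - ‖(EuclideanSpace.single ⟨0, hN⟩ (√(1 - s)) : 𝔼)‖ ^ 2 = s := by
    simp [Real.sq_sqrt (sub_nonneg.2 hs.2.le)]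
  rw [rhoKernel, this]
  positivity

end Kernels

section Averages

variable {N : ℕ}

local notation "𝔼" => EuclideanSpace ℝ (Fin N)

/-- The rescaled average `t ^ (-a) ∫ u(z) κ((x - z) / t) dz`. -/
def kavg (u κ : 𝔼 → ℝ) (a : ℕ) (t : ℝ) (x : 𝔼) : ℝ :=
  (t ^ a)⁻¹ * ∫ z, u z * κ (t⁻¹ • (x - z))

theorem kernel_eq_zero {κ : 𝔼 → ℝ} (hs : tsupport κ ⊆ closedBall 0 1) {t : ℝ} (ht : 0 < t)
    {x z : 𝔼} (hz : z ∉ closedBall x t) : κ (t⁻¹ • (x - z)) = 0 := by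
  by_contra h
  apply hz
  have h1 := hs (subset_tsupport κ h)
  rw [mem_closedBall_zero_iff, norm_smul, norm_inv, Real.norm_of_nonneg ht.le,
    inv_mul_le_iff₀ ht, mul_one] at h1
  rwa [mem_closedBall, dist_comm, dist_eq_norm]

theorem tsupport_kernel_subset {κ : 𝔼 → ℝ} (hs : tsupport κ ⊆ closedBall 0 1) {t : ℝ} (ht : 0 < t)
    (x : 𝔼) : tsupport (fun z => κ (t⁻¹ • (x - z))) ⊆ closedBall x t := by
  refine closure_minimal (fun z hz => ?_) isClosed_closedBall
  by_contra h
  exact hz (kernel_eq_zero hs ht h)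

theorem hasCompactSupport_kernel {κ : 𝔼 → ℝ} (hs : tsupport κ ⊆ closedBall 0 1) {t : ℝ}
    (ht : 0 < t) (x : 𝔼) : HasCompactSupport (fun z => κ (t⁻¹ • (x - z))) :=
  (isCompact_closedBall x t).of_isClosed_subset (isClosed_tsupport _)
    (tsupport_kernel_subset hs ht x)

theorem hasCompactSupport_smul {κ : 𝔼 → ℝ} (hs : tsupport κ ⊆ closedBall 0 1) {t : ℝ}
    (ht : 0 < t) : HasCompactSupport (fun y => κ (t⁻¹ • y)) := by
  have h : HasCompactSupport κ :=
    (isCompact_closedBall 0 1).of_isClosed_subset (isClosed_tsupport _) hs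
  exact h.comp_smul (inv_ne_zero ht.ne')

theorem contDiff_kavg {u κ : 𝔼 → ℝ} (hu : Continuous u) (hκ : ContDiff ℝ ∞ κ)
    (hs : tsupport κ ⊆ closedBall 0 1) (a : ℕ) {t : ℝ} (ht : 0 < t) :
    ContDiff ℝ ∞ (kavg u κ a t) := by
  have h := (hasCompactSupport_smul hs ht).contDiff_convolution_right (n := ⊤) (μ := volume)
    (ContinuousLinearMap.mul ℝ ℝ) (hu.locallyIntegrable) (by fun_prop)
  exact contDiff_const.mul h

theorem dirDeriv_kavg {u κ : 𝔼 → ℝ} (hu : Continuous u) (hκ : ContDiff ℝ ∞ κ)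
    (hs : tsupport κ ⊆ closedBall 0 1) (a : ℕ) {t : ℝ} (ht : 0 < t) (v : 𝔼) :
    dirDeriv v (kavg u κ a t) = kavg u (dirDeriv v κ) (a + 1) t := by
  funext x
  have hk1 : ContDiff ℝ 1 (fun y : 𝔼 => κ (t⁻¹ • y)) :=
    (hκ.comp (contDiff_const_smul _)).of_le (by simp)
  have hc := hasCompactSupport_smul hs ht
  have h := (hc.hasFDerivAt_convolution_right
    (ContinuousLinearMap.mul ℝ ℝ) (hu.locallyIntegrable (μ := volume)) hk1 x).const_mul (t ^ a)⁻¹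
  have h' : HasFDerivAt (kavg u κ a t) _ x := h
  rw [dirDeriv, h'.fderiv, _root_.smul_apply,
    convolution_precompR_apply _ hu.locallyIntegrable (hc.fderiv ℝ)
      (hk1.continuous_fderiv (by simp))]
  have e : (fun y : 𝔼 => fderiv ℝ (fun y : 𝔼 => κ (t⁻¹ • y)) y v) =
      fun y => t⁻¹ * dirDeriv v κ (t⁻¹ • y) := by
    funext y
    rw [fderiv_comp_smul]
    rfl
  have e' : ∀ y : 𝔼, fderiv ℝ (fun y : 𝔼 => κ (t⁻¹ • y)) y v = t⁻¹ * dirDeriv v κ (t⁻¹ • y) :=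
    fun y => congrFun e y
  simp only [convolution, kavg, ContinuousLinearMap.mul_apply', smul_eq_mul, e']
  rw [pow_succ, mul_inv, mul_assoc, ← integral_const_mul, ← integral_const_mul,
    ← integral_const_mul]
  congr 1
  funext z
  ring

theorem hasDerivAt_kavg_line {u κ : 𝔼 → ℝ} (hu : Continuous u) (hκ : ContDiff ℝ ∞ κ)
    (hs : tsupport κ ⊆ closedBall 0 1) (a : ℕ) {t : ℝ} (ht : 0 < t) (x v : 𝔼) (s : ℝ) :
    HasDerivAt (fun s : ℝ => kavg u κ a t (x + s • v))
      (kavg u (dirDeriv v κ) (a + 1) t (x + s • v)) s := by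
  rw [← dirDeriv_kavg hu hκ hs a ht v]
  have h1 := ((contDiff_kavg hu hκ hs a ht).differentiable (by simp) (x + s • v)).hasFDerivAt
  have h2 : HasDerivAt (fun s : ℝ => x + s • v) v s := by
    simpa using ((hasDerivAt_id s).smul_const v).const_add x
  exact h1.comp_hasDerivAt s h2

theorem lap_kernel {ϑ : 𝔼 → ℝ} (h : ContDiff ℝ ∞ ϑ) (t : ℝ) (x z : 𝔼) :
    lap N (fun z => ϑ (t⁻¹ • (x - z))) z = (t⁻¹) ^ 2 * lap N ϑ (t⁻¹ • (x - z)) := by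
  have key : ∀ (κ : 𝔼 → ℝ), ContDiff ℝ ∞ κ → ∀ v : 𝔼,
      dirDeriv v (fun z => κ (t⁻¹ • (x - z))) = fun z => -t⁻¹ * dirDeriv v κ (t⁻¹ • (x - z)) := by
    intro κ hκ v
    funext z
    have h1 : HasFDerivAt (fun z : 𝔼 => t⁻¹ • (x - z))
        (t⁻¹ • (-ContinuousLinearMap.id ℝ 𝔼)) z :=
      ((hasFDerivAt_id z).const_sub x).const_smul t⁻¹
    have h2 := (hκ.differentiable (by simp) (t⁻¹ • (x - z))).hasFDerivAt.comp z h1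
    have h3 : HasFDerivAt (fun z => κ (t⁻¹ • (x - z))) _ z := h2
    rw [dirDeriv, h3.fderiv]
    simp [dirDeriv]
  simp only [lap_eq_sum, Finset.mul_sum]
  refine Finset.sum_congr rfl fun i _ => ?_
  rw [key ϑ h]
  have h4 : ∀ (c : ℝ) (f : 𝔼 → ℝ) (_ : ContDiff ℝ ∞ f) (v : 𝔼),
      dirDeriv v (fun z => c * f z) = fun z => c * dirDeriv v f z := by
    intro c f hf v
    funext z
    rw [dirDeriv, fderiv_const_mul (hf.differentiable (by simp) z)]
    rfl
  have h5 : ContDiff ℝ ∞ (fun z : 𝔼 => dirDeriv (EuclideanSpace.single i 1) ϑ (t⁻¹ • (x - z))) := by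
    have := contDiff_dirDeriv h (EuclideanSpace.single i 1)
    fun_prop
  rw [h4 _ _ h5, key _ (contDiff_dirDeriv h _)]
  ring

theorem hasDerivAt_kavg_time {u κ ϑ : 𝔼 → ℝ} (hu : Continuous u) {a : ℕ} (h : KernelPair a κ ϑ)
    (x : 𝔼) {t : ℝ} (ht : 0 < t) :
    HasDerivAt (fun t => kavg u κ a t x)
      ((t ^ (a + 1))⁻¹ * ∫ z, u z * lap N ϑ (t⁻¹ • (x - z))) t := by
  set G' : ℝ → 𝔼 → ℝ := fun s z =>
    u z * ((s ^ (a + 1))⁻¹ * lap N ϑ (s⁻¹ • (x - z))) with hG'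
  set G : ℝ → 𝔼 → ℝ := fun s z => u z * ((s ^ a)⁻¹ * κ (s⁻¹ • (x - z))) with hG
  have hlap := contDiff_lap h.contDiff_right
  have hsl : tsupport (lap N ϑ) ⊆ closedBall 0 1 := by
    refine closure_minimal (fun y hy => ?_) isClosed_closedBall
    by_contra hy'
    apply hy
    rw [lap_eq_sum]
    refine Finset.sum_eq_zero fun i _ => ?_
    by_contra h0
    exact hy' (h.tsupport_right (tsupport_dirDeriv_subset _ _ (tsupport_dirDeriv_subset _ _
      (subset_tsupport _ h0))))
  have hcs : HasCompactSupport (lap N ϑ) :=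
    (isCompact_closedBall 0 1).of_isClosed_subset (isClosed_tsupport _) hsl
  obtain ⟨C, hC⟩ := hcs.exists_bound_of_continuous hlap.continuous
  have hC0 : 0 ≤ C := (norm_nonneg _).trans (hC 0)
  have hder : ∀ z, ∀ s ∈ Ioo (t / 2) (2 * t), HasDerivAt (fun s => G s z) (G' s z) s := by
    intro z s hs
    have hs0 : 0 < s := (half_pos ht).trans hs.1
    refine HasDerivAt.const_mul (u z) ?_
    have h1 : HasDerivAt (fun s : ℝ => s⁻¹ • (x - z)) ((-(s ^ 2)⁻¹) • (x - z)) s :=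
      (hasDerivAt_inv hs0.ne').smul_const _
    have h2 := (h.contDiff_left.differentiable (by simp)
      (s⁻¹ • (x - z))).hasFDerivAt.comp_hasDerivAt s h1
    have h3 : HasDerivAt (fun s : ℝ => (s ^ a)⁻¹) (-(a * s ^ (a - 1)) / (s ^ a) ^ 2) s :=
      (hasDerivAt_pow a s).fun_inv (by positivity)
    refine (h3.mul h2).congr_deriv ?_
    have e := h.euler (s⁻¹ • (x - z))
    have e2 : lap N ϑ (s⁻¹ • (x - z)) =
      -(a * κ (s⁻¹ • (x - z)) + fderiv ℝ κ (s⁻¹ • (x - z)) (s⁻¹ • (x - z))) := by linarith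
    rw [e2]
    simp only [map_smul, smul_eq_mul, Function.comp_apply]
    rcases a with _ | a
    · simp; field_simp
    · push_cast
      field_simp
      ring
  have hcont : ∀ s, Continuous (G s) := by
    intro s
    have := h.contDiff_left.continuous
    fun_prop
  have hcont' : ∀ s, Continuous (G' s) := by
    intro s
    have := hlap.continuous
    fun_prop
  have hmain := hasDerivAt_integral_of_dominated_loc_of_deriv_le (μ := (volume : Measure 𝔼))
    (F := G) (F' := G') (x₀ := t) (s := Ioo (t / 2) (2 * t))
    (bound := (closedBall x (2 * t)).indicator fun z => |u z| * (((t / 2) ^ (a + 1))⁻¹ * C))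
    (Ioo_mem_nhds (by linarith) (by linarith))
    (Eventually.of_forall fun s => (hcont s).aestronglyMeasurable) ?_
    (hcont' t).aestronglyMeasurable (Eventually.of_forall fun z s hs => ?_) ?_
    (Eventually.of_forall hder)
  · refine (hmain.2.congr_deriv ?_).congr_of_eventuallyEq ?_
    · rw [← integral_const_mul]
      congr 1
      funext z
      simp only [hG']
      ring
    · refine Eventually.of_forall fun s => ?_
      simp only [kavg, hG]
      rw [← integral_const_mul]
      congr 1
      funext z
      ring
  · refine (hcont t).integrable_of_hasCompactSupport ?_
    have := (hasCompactSupport_kernel h.tsupport_left ht x).mul_left (f := fun z => u z * (t ^ a)⁻¹)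
    simpa [hG, mul_assoc, Pi.mul_def] using this
  · have hs0 : 0 < s := (half_pos ht).trans hs.1
    by_cases hz : z ∈ closedBall x (2 * t)
    · rw [indicator_of_mem hz, hG']
      simp only [norm_mul, norm_inv, norm_pow]
      rw [Real.norm_of_nonneg hs0.le]
      have := hC (s⁻¹ • (x - z))
      have hs1 := hs.1
      have h1 : t / 2 ≤ s := hs1.le
      rw [Real.norm_eq_abs]
      gcongr
    · have : z ∉ closedBall x s := fun h' => hz (closedBall_subset_closedBall hs.2.le h')
      rw [indicator_of_notMem hz, hG']
      simp [kernel_eq_zero hsl hs0 this]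
  · rw [integrable_indicator_iff measurableSet_closedBall]
    exact (Continuous.continuousOn (by fun_prop)).integrableOn_compact (isCompact_closedBall _ _)

end Averages

section ObstacleAverages

variable {N : ℕ}

local notation "𝔼" => EuclideanSpace ℝ (Fin N)

theorem integral_comp_kernel (f : 𝔼 → ℝ) {t : ℝ} (ht : 0 < t) (x : 𝔼) :
    ∫ z, f (t⁻¹ • (x - z)) = t ^ N * ∫ y, f y := by
  rw [integral_sub_left_eq_self (fun z => f (t⁻¹ • z)) volume x,
    Measure.integral_comp_smul]
  simp [abs_of_pos ht]

theorem kavg_eq_integral (u κ : 𝔼 → ℝ) {t : ℝ} (ht : 0 < t) (x : 𝔼) :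
    kavg u κ N t x = ∫ y, u (x - t • y) * κ y := by
  have h := integral_comp_kernel (fun y => u (x - t • y) * κ y) ht x
  have e : ∀ z, u (x - t • t⁻¹ • (x - z)) * κ (t⁻¹ • (x - z)) = u z * κ (t⁻¹ • (x - z)) := by
    intro z
    rw [smul_smul, mul_inv_cancel₀ ht.ne', one_smul, sub_sub_cancel]
  simp only [e] at h
  rw [kavg, h, ← mul_assoc, inv_mul_cancel₀ (by positivity), one_mul]

theorem tendsto_kavg {u κ : 𝔼 → ℝ} (hu : Continuous u) (hκ : Continuous κ)
    (hs : tsupport κ ⊆ closedBall 0 1) (x : 𝔼) :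
    Tendsto (fun t => kavg u κ N t x) (𝓝[>] 0) (𝓝 ((∫ y, κ y) * u x)) := by
  have hc : Continuous fun t : ℝ => ∫ y in closedBall (0 : 𝔼) 1, u (x - t • y) * κ y :=
    continuous_parametric_integral_of_continuous (by fun_prop) (isCompact_closedBall 0 1)
  have hout : ∀ t : ℝ, ∫ y in closedBall (0 : 𝔼) 1, u (x - t • y) * κ y =
      ∫ y, u (x - t • y) * κ y := by
    intro t
    apply setIntegral_eq_integral_of_forall_compl_eq_zero
    intro y hy
    have : κ y = 0 := by
      by_contra h
      exact hy (hs (subset_tsupport κ h))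
    rw [this, mul_zero]
  simp only [hout] at hc
  have h0 := (hc.tendsto 0).mono_left (nhdsWithin_le_nhds (s := Ioi 0))
  simp only [zero_smul, sub_zero, integral_const_mul] at h0
  rw [mul_comm]
  refine h0.congr' ?_
  filter_upwards [self_mem_nhdsWithin] with t ht
  exact (kavg_eq_integral u κ ht x).symm

theorem kavg_dirDeriv_eq {u κ : 𝔼 → ℝ} (hu : ContDiff ℝ 1 u) (hκ : ContDiff ℝ ∞ κ)
    (hs : tsupport κ ⊆ closedBall 0 1) (a : ℕ) {t : ℝ} (ht : 0 < t) (v x : 𝔼) :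
    kavg u (dirDeriv v κ) (a + 1) t x = kavg (dirDeriv v u) κ a t x := by
  have hd : ∀ z, fderiv ℝ (fun z => κ (t⁻¹ • (x - z))) z v =
      -t⁻¹ * dirDeriv v κ (t⁻¹ • (x - z)) := by
    intro z
    have h1 : HasFDerivAt (fun z : 𝔼 => t⁻¹ • (x - z))
        (t⁻¹ • (-ContinuousLinearMap.id ℝ 𝔼)) z :=
      ((hasFDerivAt_id z).const_sub x).const_smul t⁻¹
    have h2 := (hκ.differentiable (by simp) (t⁻¹ • (x - z))).hasFDerivAt.comp z h1
    have h3 : HasFDerivAt (fun z => κ (t⁻¹ • (x - z))) _ z := h2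
    rw [h3.fderiv]
    simp [dirDeriv]
  have hcs := hasCompactSupport_kernel hs ht x
  have hkc : Continuous fun z => κ (t⁻¹ • (x - z)) := by
    have := hκ.continuous
    fun_prop
  have hkd : ContDiff ℝ ∞ fun z => κ (t⁻¹ • (x - z)) := by fun_prop
  have hdc : Continuous fun z => fderiv ℝ (fun z => κ (t⁻¹ • (x - z))) z v :=
    (hkd.continuous_fderiv (by simp)).clm_apply continuous_const
  have hduc : Continuous fun z => fderiv ℝ u z v :=
    (hu.continuous_fderiv (by simp)).clm_apply continuous_const
  have h := integral_mul_fderiv_eq_neg_fderiv_mul_of_integrable (μ := (volume : Measure 𝔼))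
    (f := u) (g := fun z => κ (t⁻¹ • (x - z))) (v := v)
    ((hduc.mul hkc).integrable_of_hasCompactSupport hcs.mul_left)
    ((hu.continuous.mul hdc).integrable_of_hasCompactSupport
      ((hcs.fderiv_apply (𝕜 := ℝ) v).mul_left))
    ((hu.continuous.mul hkc).integrable_of_hasCompactSupport hcs.mul_left)
    (fun z _ => hu.differentiable (by simp) z)
    (fun z _ => hkd.differentiable (by simp) z)
  simp only [hd] at h
  have e : ∫ z, u z * (-t⁻¹ * dirDeriv v κ (t⁻¹ • (x - z))) =
      -(t⁻¹ * ∫ z, u z * dirDeriv v κ (t⁻¹ • (x - z))) := by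
    rw [← integral_const_mul, ← integral_neg]
    congr 1
    funext z
    ring
  rw [e, neg_inj] at h
  simp only [kavg]
  rw [pow_succ, mul_inv, mul_assoc, h]
  rfl

theorem integral_dirDeriv_eq_zero {ϑ : 𝔼 → ℝ} (hϑ : ContDiff ℝ ∞ ϑ)
    (hs : tsupport ϑ ⊆ closedBall 0 1) (v : 𝔼) : ∫ y, dirDeriv v ϑ y = 0 := by
  have hcs : HasCompactSupport ϑ :=
    (isCompact_closedBall 0 1).of_isClosed_subset (isClosed_tsupport _) hs
  have hdc : Continuous fun z => fderiv ℝ ϑ z v :=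
    (hϑ.continuous_fderiv (by simp)).clm_apply continuous_const
  have h := integral_mul_fderiv_eq_neg_fderiv_mul_of_integrable (μ := (volume : Measure 𝔼))
    (f := fun _ => (1 : ℝ)) (g := ϑ) (v := v) (by simp)
    (by simpa using hdc.integrable_of_hasCompactSupport (hcs.fderiv_apply (𝕜 := ℝ) v))
    (by simpa using hϑ.continuous.integrable_of_hasCompactSupport hcs)
    (fun z _ => by simp)
    (fun z _ => hϑ.differentiable (by simp) z)
  have h' : ∫ z, fderiv ℝ ϑ z v = 0 := by simpa using h
  exact h'

variable {M : ℝ} {Ω : Set (EuclideanSpace ℝ (Fin N))} {u : EuclideanSpace ℝ (Fin N) → ℝ}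

/-- On `B(x,t)` the weak equation tested against a rescaled kernel. -/
theorem MemP.integral_lap_kernel (h : MemP N 1 0 M Ω u) {ϑ : 𝔼 → ℝ} (hϑ : ContDiff ℝ ∞ ϑ)
    (hs : tsupport ϑ ⊆ closedBall 0 1) {x : 𝔼} {t : ℝ} (ht : 0 < t)
    (hx : closedBall x t ⊆ ball 0 1) :
    ∫ z, u z * lap N ϑ (t⁻¹ • (x - z)) = t ^ 2 * ∫ z in Ω, ϑ (t⁻¹ • (x - z)) := by
  have h1 := h.2.2.1 (fun z => ϑ (t⁻¹ • (x - z))) (by fun_prop)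
    ((tsupport_kernel_subset hs ht x).trans hx)
  simp only [lap_kernel hϑ] at h1
  rw [← h1, ← integral_const_mul]
  congr 1
  funext z
  field_simp

theorem MemP.hasDerivAt_kavg (h : MemP N 1 0 M Ω u) {κ ϑ : 𝔼 → ℝ} {a : ℕ}
    (hp : KernelPair a κ ϑ) {x : 𝔼} {t : ℝ} (ht : 0 < t) (hx : closedBall x t ⊆ ball 0 1) :
    HasDerivAt (fun t => kavg u κ a t x)
      ((t ^ (a + 1))⁻¹ * (t ^ 2 * ∫ z in Ω, ϑ (t⁻¹ • (x - z)))) t := by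
  rw [← h.integral_lap_kernel hp.contDiff_right hp.tsupport_right ht hx]
  exact hasDerivAt_kavg_time h.2.1.continuous hp x ht

theorem MemP.exists_hasDerivAt_kavg (h : MemP N 1 0 M Ω u) {κ ϑ : 𝔼 → ℝ} {a : ℕ}
    (hp : KernelPair (a + 1) κ ϑ) (h0 : ∫ y, ϑ y = 0) {B : ℝ} (hB : ∀ y, |ϑ y| ≤ B)
    {x : 𝔼} {t : ℝ} (ht : 0 < t) (hx : closedBall x t ⊆ ball 0 1) :
    ∃ D, HasDerivAt (fun t => kavg u κ (a + 1) t x) D t ∧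
      |D| ≤ B * ((t ^ a)⁻¹ * volume.real (Ωᶜ ∩ closedBall x t)) := by
  refine ⟨_, h.hasDerivAt_kavg hp ht hx, ?_⟩
  have hB0 : 0 ≤ B := (abs_nonneg _).trans (hB 0)
  have hcont : Continuous fun z => ϑ (t⁻¹ • (x - z)) := by
    have := hp.contDiff_right.continuous
    fun_prop
  have hinteg := hcont.integrable_of_hasCompactSupport (μ := volume)
    (hasCompactSupport_kernel hp.tsupport_right ht x)
  have h1 := integral_add_compl h.1.measurableSet hinteg
  rw [integral_comp_kernel ϑ ht x, h0, mul_zero] at h1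
  have h2 : ∫ z in Ωᶜ, ϑ (t⁻¹ • (x - z)) =
      ∫ z in Ωᶜ ∩ closedBall x t, ϑ (t⁻¹ • (x - z)) := by
    refine setIntegral_eq_of_subset_of_forall_sdiff_eq_zero h.1.measurableSet.compl
      inter_subset_left fun z hz => ?_
    exact kernel_eq_zero hp.tsupport_right ht fun hz' => hz.2 ⟨hz.1, hz'⟩
  have h3 : |∫ z in Ω, ϑ (t⁻¹ • (x - z))| ≤ B * volume.real (Ωᶜ ∩ closedBall x t) := by
    have e : ∫ z in Ω, ϑ (t⁻¹ • (x - z)) = -∫ z in Ωᶜ ∩ closedBall x t, ϑ (t⁻¹ • (x - z)) := by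
      rw [← h2]; linarith
    rw [e, abs_neg, ← Real.norm_eq_abs]
    refine norm_setIntegral_le_of_norm_le_const ?_ fun z _ => hB _
    exact (measure_mono inter_subset_right).trans_lt measure_closedBall_lt_top
  rw [abs_mul, abs_mul, abs_of_pos (by positivity), abs_of_pos (by positivity)]
  calc (t ^ (a + 1 + 1))⁻¹ * (t ^ 2 * |∫ z in Ω, ϑ (t⁻¹ • (x - z))|)
      ≤ (t ^ (a + 1 + 1))⁻¹ * (t ^ 2 * (B * volume.real (Ωᶜ ∩ closedBall x t))) := by gcongr
    _ = B * ((t ^ a)⁻¹ * volume.real (Ωᶜ ∩ closedBall x t)) := by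
      field_simp
      ring

theorem MemP.abs_kavg_le (h : MemP N 1 0 M Ω u) {κ : 𝔼 → ℝ} (hs : tsupport κ ⊆ closedBall 0 1)
    {B : ℝ} (hB : ∀ y, |κ y| ≤ B) (a : ℕ) {x : 𝔼} {t : ℝ} (ht : 0 < t)
    (hx : closedBall x t ⊆ ball 0 1) :
    |kavg u κ a t x| ≤ (t ^ a)⁻¹ * (M * B * volume.real (ball (0 : 𝔼) 1)) := by
  have hB0 : 0 ≤ B := (abs_nonneg _).trans (hB 0)
  have hM : 0 ≤ M := (abs_nonneg _).trans (h.2.2.2.2.1 0 (by simp))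
  rw [kavg, abs_mul, abs_of_pos (by positivity)]
  gcongr
  have e : ∫ z, u z * κ (t⁻¹ • (x - z)) = ∫ z in ball 0 1, u z * κ (t⁻¹ • (x - z)) := by
    symm
    apply setIntegral_eq_integral_of_forall_compl_eq_zero
    intro z hz
    rw [kernel_eq_zero hs ht fun hz' => hz (hx hz'), mul_zero]
  rw [e, ← Real.norm_eq_abs]
  refine norm_setIntegral_le_of_norm_le_const measure_ball_lt_top fun z hz => ?_
  rw [norm_mul]
  exact mul_le_mul (h.2.2.2.2.1 z hz) (hB _) (norm_nonneg _) hM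

theorem dirDeriv_iteratedFDeriv {κ : 𝔼 → ℝ} (hκ : ContDiff ℝ ∞ κ) {n : ℕ} (m : Fin n → 𝔼)
    (v : 𝔼) : dirDeriv v (fun y => iteratedFDeriv ℝ n κ y m) =
      fun y => iteratedFDeriv ℝ (n + 1) κ y (Fin.cons v m) := by
  funext y
  have hd : HasFDerivAt (iteratedFDeriv ℝ n κ) (fderiv ℝ (iteratedFDeriv ℝ n κ) y) y :=
    (hκ.differentiable_iteratedFDeriv (m := n)
      (by exact_mod_cast WithTop.coe_lt_coe.2 (ENat.natCast_lt_top n)) y).hasFDerivAt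
  have h1 := ((ContinuousMultilinearMap.apply ℝ (fun _ : Fin n => 𝔼) ℝ m).hasFDerivAt.comp y hd)
  have h2 : HasFDerivAt (fun y => iteratedFDeriv ℝ n κ y m) _ y := h1
  rw [dirDeriv, h2.fderiv, iteratedFDeriv_succ_apply_left]
  simp

theorem exists_dirDeriv_bounds {κ : 𝔼 → ℝ} (hκ : ContDiff ℝ ∞ κ)
    (hs : tsupport κ ⊆ closedBall 0 1) :
    ∃ C : ℝ, 0 < C ∧ ∀ y v₁ v₂ v₃ : 𝔼, |κ y| ≤ C ∧ |dirDeriv v₁ κ y| ≤ C * ‖v₁‖ ∧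
      |dirDeriv v₂ (dirDeriv v₁ κ) y| ≤ C * (‖v₁‖ * ‖v₂‖) ∧
      |dirDeriv v₃ (dirDeriv v₂ (dirDeriv v₁ κ)) y| ≤ C * (‖v₁‖ * ‖v₂‖ * ‖v₃‖) := by
  have hcs : HasCompactSupport κ :=
    (isCompact_closedBall 0 1).of_isClosed_subset (isClosed_tsupport _) hs
  have hb : ∀ n : ℕ, ∃ C, ∀ y, ‖iteratedFDeriv ℝ n κ y‖ ≤ C := fun n =>
    (hcs.iteratedFDeriv n).exists_bound_of_continuous
      (hκ.continuous_iteratedFDeriv (by exact_mod_cast le_top))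
  choose C hC using hb
  have e0 : κ = fun y => iteratedFDeriv ℝ 0 κ y Fin.elim0 := by
    funext y
    simp
  have e1 : ∀ v₁ : 𝔼, dirDeriv v₁ κ = fun y => iteratedFDeriv ℝ 1 κ y (Fin.cons v₁ Fin.elim0) := by
    intro v₁
    conv_lhs => rw [e0]
    exact dirDeriv_iteratedFDeriv hκ _ v₁
  have e2 : ∀ v₁ v₂ : 𝔼, dirDeriv v₂ (dirDeriv v₁ κ) =
      fun y => iteratedFDeriv ℝ 2 κ y (Fin.cons v₂ (Fin.cons v₁ Fin.elim0)) := by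
    intro v₁ v₂
    rw [e1]
    exact dirDeriv_iteratedFDeriv hκ _ v₂
  have e3 : ∀ v₁ v₂ v₃ : 𝔼, dirDeriv v₃ (dirDeriv v₂ (dirDeriv v₁ κ)) =
      fun y => iteratedFDeriv ℝ 3 κ y (Fin.cons v₃ (Fin.cons v₂ (Fin.cons v₁ Fin.elim0))) := by
    intro v₁ v₂ v₃
    rw [e2]
    exact dirDeriv_iteratedFDeriv hκ _ v₃
  have key : ∀ (n : ℕ) (y : 𝔼) (m : Fin n → 𝔼) {K : ℝ}, C n ≤ K →
      |iteratedFDeriv ℝ n κ y m| ≤ K * ∏ i, ‖m i‖ := by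
    intro n y m K hK
    rw [← Real.norm_eq_abs]
    refine ((iteratedFDeriv ℝ n κ y).le_opNorm m).trans ?_
    gcongr
    exact (hC n y).trans hK
  refine ⟨max 1 (max (C 0) (max (C 1) (max (C 2) (C 3)))), by positivity,
    fun y v₁ v₂ v₃ => ⟨?_, ?_, ?_, ?_⟩⟩
  · have := key 0 y Fin.elim0 (K := max 1 (max (C 0) (max (C 1) (max (C 2) (C 3))))) (by simp)
    simpa using this
  · rw [e1]
    refine (key 1 y _ (K := max 1 (max (C 0) (max (C 1) (max (C 2) (C 3))))) (by simp)).trans_eq ?_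
    simp
  · rw [e2]
    refine (key 2 y _ (K := max 1 (max (C 0) (max (C 1) (max (C 2) (C 3))))) (by simp)).trans_eq ?_
    simp [Fin.prod_univ_two, mul_comm]
  · rw [e3]
    refine (key 3 y _ (K := max 1 (max (C 0) (max (C 1) (max (C 2) (C 3))))) (by simp)).trans_eq ?_
    have e : ∏ i : Fin 3, ‖(Fin.cons v₃ (Fin.cons v₂ (Fin.cons v₁ Fin.elim0)) : Fin 3 → 𝔼) i‖ =
        ‖v₃‖ * ‖v₂‖ * ‖v₁‖ := Fin.prod_univ_three _
    rw [e]
    ring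

end ObstacleAverages

section ScaleComparison

variable {N : ℕ}

local notation "𝔼" => EuclideanSpace ℝ (Fin N)

variable {M : ℝ} {Ω : Set (EuclideanSpace ℝ (Fin N))} {u : EuclideanSpace ℝ (Fin N) → ℝ}

theorem MemP.abs_kavg_sub_le (h : MemP N 1 0 M Ω u) {κ ϑ : 𝔼 → ℝ} {a : ℕ}
    (hp : KernelPair (a + 1) κ ϑ) (h0 : ∫ y, ϑ y = 0) {B : ℝ} (hB : ∀ y, |ϑ y| ≤ B)
    {x : 𝔼} {s t : ℝ} (hs : 0 < s) (hst : s ≤ t) (hx : closedBall x t ⊆ ball 0 1)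
    {G G' : ℝ → ℝ} (hG : ∀ r, HasDerivAt G (G' r) r)
    (hle : ∀ r, s ≤ r → r ≤ t → B * ((r ^ a)⁻¹ * volume.real (Ωᶜ ∩ closedBall x r)) ≤ G' r) :
    |kavg u κ (a + 1) t x - kavg u κ (a + 1) s x| ≤ G t - G s := by
  have hD : ∀ r, ∃ D, r ∈ Icc s t → HasDerivAt (fun t => kavg u κ (a + 1) t x) D r ∧
      |D| ≤ G' r := by
    intro r
    by_cases hr : r ∈ Icc s t
    · obtain ⟨D, h1, h2⟩ := h.exists_hasDerivAt_kavg hp h0 hB (hs.trans_le hr.1)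
        ((closedBall_subset_closedBall hr.2).trans hx)
      exact ⟨D, fun _ => ⟨h1, h2.trans (hle r hr.1 hr.2)⟩⟩
    · exact ⟨0, fun h => absurd h hr⟩
  choose D hD using hD
  have := image_norm_le_of_norm_deriv_right_le_deriv_boundary
    (f := fun r => kavg u κ (a + 1) r x - kavg u κ (a + 1) s x) (f' := D) (a := s) (b := t)
    (B := fun r => G r - G s) (B' := G')
    (fun r hr => ((hD r hr).1.continuousAt.sub continuousAt_const).continuousWithinAt)
    (fun r hr => ((hD r (Ico_subset_Icc_self hr)).1.sub_const _).hasDerivWithinAt)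
    (by simp) (fun r => (hG r).sub_const _)
    (fun r hr => (hD r (Ico_subset_Icc_self hr)).2) (right_mem_Icc.2 hst)
  simpa using this

theorem MemP.abs_kavg_sub_le_of_const (h : MemP N 1 0 M Ω u) {κ ϑ : 𝔼 → ℝ} {a : ℕ}
    (hp : KernelPair (a + 1) κ ϑ) (h0 : ∫ y, ϑ y = 0) {B : ℝ} (hB : ∀ y, |ϑ y| ≤ B)
    {x : 𝔼} {s t : ℝ} (hs : 0 < s) (hst : s ≤ t) (hx : closedBall x t ⊆ ball 0 1) {D : ℝ}
    (hle : ∀ r, s ≤ r → r ≤ t → B * ((r ^ a)⁻¹ * volume.real (Ωᶜ ∩ closedBall x r)) ≤ D) :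
    |kavg u κ (a + 1) t x - kavg u κ (a + 1) s x| ≤ D * (t - s) := by
  have := h.abs_kavg_sub_le hp h0 hB hs hst hx (G := fun r => D * r) (G' := fun _ => D)
    (fun r => by simpa using (hasDerivAt_id r).const_mul D) hle
  linarith

/-- If the complement of `Ω` has small density at scales above `α`, averages of the gradient
approximate the gradient to order `α`. -/
theorem MemP.abs_kavg_sub_dirDeriv_le (h : MemP N 1 0 M Ω u) {B : ℝ}
    (hB : ∀ v y : 𝔼, |dirDeriv v (thetaKernel N) y| ≤ B * ‖v‖)
    {x : 𝔼} {t : ℝ} (ht : 0 < t) (hx : closedBall x t ⊆ ball 0 1)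
    {D α : ℝ} (hB0 : 0 ≤ B) (hα : 0 < α)
    (h1 : ∀ r, 0 < r → r ≤ t → volume.real (Ωᶜ ∩ closedBall x r) ≤ D * r ^ N)
    (h2 : ∀ r, 0 < r → r ≤ t → volume.real (Ωᶜ ∩ closedBall x r) * r ^ 2 ≤ D * α ^ 2 * r ^ N)
    (v : 𝔼) :
    |kavg u (dirDeriv v (rhoKernel N)) (N + 1) t x - (∫ y, rhoKernel N y) * dirDeriv v u x| ≤
      B * D * 4 * α * ‖v‖ := by
  have hlim : Tendsto (fun s => kavg u (dirDeriv v (rhoKernel N)) (N + 1) s x) (𝓝[>] 0)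
      (𝓝 ((∫ y, rhoKernel N y) * dirDeriv v u x)) := by
    have hc : Continuous (dirDeriv v u) :=
      (h.2.1.continuous_fderiv (by simp)).clm_apply continuous_const
    refine (tendsto_kavg hc contDiff_rhoKernel.continuous tsupport_rhoKernel x).congr' ?_
    filter_upwards [self_mem_nhdsWithin] with s hs
    exact (kavg_dirDeriv_eq h.2.1 contDiff_rhoKernel tsupport_rhoKernel N hs v x).symm
  have hD0 : 0 ≤ D := by
    have := (measureReal_nonneg).trans (h1 t ht le_rfl)
    exact nonneg_of_mul_nonneg_left this (by positivity)
  have key : ∀ᶠ s in 𝓝[>] (0 : ℝ), |kavg u (dirDeriv v (rhoKernel N)) (N + 1) t x -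
      kavg u (dirDeriv v (rhoKernel N)) (N + 1) s x| ≤ B * D * 4 * α * ‖v‖ := by
    filter_upwards [Ioc_mem_nhdsGT ht] with s hs
    have hG : ∀ r : ℝ, HasDerivAt (fun r => B * ‖v‖ * D * 2 * α * Real.arctan (α⁻¹ * r))
        (B * ‖v‖ * D * 2 * α * (1 / (1 + (α⁻¹ * r) ^ 2) * (α⁻¹ * 1))) r := fun r =>
      (((hasDerivAt_id r).const_mul α⁻¹).arctan).const_mul _
    have hb := h.abs_kavg_sub_le (kernelPair_rho_theta.dirDeriv v)
      (integral_dirDeriv_eq_zero contDiff_thetaKernel tsupport_thetaKernel v) (hB v)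
      hs.1 hs.2 hx hG ?_
    · refine hb.trans ?_
      have a1 : Real.arctan (α⁻¹ * t) ≤ 2 := (Real.arctan_lt_pi_div_two _).le.trans
        (by linarith [Real.pi_le_four])
      have a2 : 0 ≤ Real.arctan (α⁻¹ * s) := Real.arctan_nonneg.2 (by have := hs.1; positivity)
      have : 0 ≤ B * ‖v‖ * D * 2 * α := by positivity
      nlinarith
    · intro r hr1 hr2
      have hr : 0 < r := hs.1.trans_le hr1
      have e1 := h1 r hr hr2
      have e2 := h2 r hr hr2
      have e3 : (r ^ N)⁻¹ * volume.real (Ωᶜ ∩ closedBall x r) ≤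
          D * 2 * (α ^ 2 / (α ^ 2 + r ^ 2)) := by
        rw [inv_mul_le_iff₀ (by positivity), ← mul_div_assoc, ← mul_div_assoc,
          le_div_iff₀ (by positivity)]
        nlinarith [mul_le_mul_of_nonneg_right e1 (sq_nonneg α)]
      have e4 : B * ‖v‖ * D * 2 * α * (1 / (1 + (α⁻¹ * r) ^ 2) * (α⁻¹ * 1)) =
          B * ‖v‖ * (D * 2 * (α ^ 2 / (α ^ 2 + r ^ 2))) := by
        field_simp
      rw [e4]
      gcongr
  exact le_of_tendsto ((tendsto_const_nhds.sub hlim).abs) key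

theorem volume_real_inter_closedBall_le (A : Set 𝔼) (x : 𝔼) {r : ℝ} (hr : 0 ≤ r) :
    volume.real (A ∩ closedBall x r) ≤ volume.real (ball (0 : 𝔼) 1) * r ^ N := by
  have h1 : volume.real (A ∩ closedBall x r) ≤ volume.real (closedBall x r) :=
    measureReal_mono inter_subset_right measure_closedBall_lt_top.ne
  have h2 := Measure.addHaar_real_closedBall (volume : Measure 𝔼) x hr
  simp only [finrank_euclideanSpace, Fintype.card_fin] at h2
  linarith [mul_comm (r ^ N) (volume.real (ball (0 : 𝔼) 1))]

theorem exists_kernel_bounds (N : ℕ) : ∃ K : ℝ, 0 < K ∧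
    ∀ κ ∈ ({rhoKernel N, thetaKernel N} : Set (EuclideanSpace ℝ (Fin N) → ℝ)),
    ∀ y v₁ v₂ v₃ : EuclideanSpace ℝ (Fin N), |κ y| ≤ K ∧ |dirDeriv v₁ κ y| ≤ K * ‖v₁‖ ∧
      |dirDeriv v₂ (dirDeriv v₁ κ) y| ≤ K * (‖v₁‖ * ‖v₂‖) ∧
      |dirDeriv v₃ (dirDeriv v₂ (dirDeriv v₁ κ)) y| ≤ K * (‖v₁‖ * ‖v₂‖ * ‖v₃‖) := by
  obtain ⟨C, hC, h1⟩ := exists_dirDeriv_bounds (contDiff_rhoKernel (N := N)) tsupport_rhoKernel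
  obtain ⟨D, hD, h2⟩ := exists_dirDeriv_bounds (contDiff_thetaKernel (N := N)) tsupport_thetaKernel
  refine ⟨max C D, by positivity, ?_⟩
  rintro κ (rfl | rfl) y v₁ v₂ v₃
  · obtain ⟨a, b, c, d⟩ := h1 y v₁ v₂ v₃
    have : C ≤ max C D := le_max_left _ _
    exact ⟨a.trans this, b.trans (by gcongr), c.trans (by gcongr), d.trans (by gcongr)⟩
  · obtain ⟨a, b, c, d⟩ := h2 y v₁ v₂ v₃
    have : D ≤ max C D := le_max_right _ _
    exact ⟨a.trans this, b.trans (by gcongr), c.trans (by gcongr), d.trans (by gcongr)⟩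

end ScaleComparison

section DyadicStep

variable {N : ℕ}

local notation "𝔼" => EuclideanSpace ℝ (Fin N)

/-- Averaged second derivatives. -/
def kHess (u : 𝔼 → ℝ) (t : ℝ) (x v w : 𝔼) : ℝ :=
  kavg u (dirDeriv w (dirDeriv v (rhoKernel N))) (N + 2) t x

/-- Averaged third derivatives. -/
def kThird (u : 𝔼 → ℝ) (t : ℝ) (x v w q : 𝔼) : ℝ :=
  kavg u (dirDeriv q (dirDeriv w (dirDeriv v (rhoKernel N)))) (N + 3) t x

/-- The set `A` has density at most `D δ² (r / t)²` in every ball of radius `t` inside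
`closedBall z r`. -/
def SmallIn (A : Set 𝔼) (z : 𝔼) (r D δ : ℝ) : Prop :=
  ∀ (y : 𝔼) (t : ℝ), 0 < t → t ≤ r → closedBall y t ⊆ closedBall z r →
    volume.real (A ∩ closedBall y t) * t ^ 2 ≤ D * (δ * r) ^ 2 * t ^ N

/-- Dyadic control of the averaged Hessian along the coincidence set and of the averaged
third derivatives. -/
def TaylorBounds (u : 𝔼 → ℝ) (A : Set 𝔼) (z : 𝔼) (r η d : ℝ) : Prop :=
  (∀ y ∈ A, y ∈ closedBall z r → ∀ v, |kHess u r z v (y - z)| ≤ η * r * ‖v‖) ∧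
  ∀ x ∈ closedBall z (r / 2), ∀ v w q, |kThird u (r / 2) x v w q| ≤ d / r * (‖v‖ * ‖w‖ * ‖q‖)

theorem abs_sub_sub_le_of_deriv2 {f f' f'' : ℝ → ℝ} {b : ℝ} (h1 : ∀ s, HasDerivAt f (f' s) s)
    (h2 : ∀ s, HasDerivAt f' (f'' s) s) (hb : ∀ s ∈ Icc (0 : ℝ) 1, |f'' s| ≤ b) :
    |f 1 - f 0 - f' 0| ≤ b := by
  have hb0 : 0 ≤ b := (abs_nonneg _).trans (hb 0 (by simp))
  have k1 : ∀ s ∈ Icc (0 : ℝ) 1, |f' s - f' 0| ≤ b := by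
    intro s hs
    have := (convex_Icc (0 : ℝ) 1).norm_image_sub_le_of_norm_hasDerivWithin_le
      (fun x _ => (h2 x).hasDerivWithinAt) (fun x hx => (Real.norm_eq_abs _).trans_le (hb x hx))
      (left_mem_Icc.2 zero_le_one) hs
    rw [Real.norm_eq_abs, Real.norm_eq_abs, sub_zero, abs_of_nonneg hs.1] at this
    exact this.trans (mul_le_of_le_one_right hb0 hs.2)
  have := (convex_Icc (0 : ℝ) 1).norm_image_sub_le_of_norm_hasDerivWithin_le
      (f := fun s => f s - s * f' 0)
      (fun x _ => ((h1 x).sub ((hasDerivAt_id x).mul_const (f' 0))).hasDerivWithinAt)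
      (fun x hx => by simpa using k1 x hx)
      (left_mem_Icc.2 zero_le_one) (right_mem_Icc.2 zero_le_one)
  simp only [one_mul, zero_mul, sub_zero, norm_one, mul_one, Real.norm_eq_abs] at this
  rwa [sub_right_comm] at this

theorem abs_kavg_taylor_le {u : 𝔼 → ℝ} (hu : Continuous u) {t b : ℝ} (ht : 0 < t) (z y v : 𝔼)
    (hb : ∀ x ∈ segment ℝ z y, |kThird u t x v (y - z) (y - z)| ≤ b) :
    |kavg u (dirDeriv v (rhoKernel N)) (N + 1) t y -
      kavg u (dirDeriv v (rhoKernel N)) (N + 1) t z - kHess u t z v (y - z)| ≤ b := by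
  have c1 := contDiff_dirDeriv (contDiff_rhoKernel (N := N)) v
  have t1 := (tsupport_dirDeriv_subset (rhoKernel N) v).trans tsupport_rhoKernel
  have c2 := contDiff_dirDeriv c1 (y - z)
  have t2 := (tsupport_dirDeriv_subset (dirDeriv v (rhoKernel N)) (y - z)).trans t1
  have := abs_sub_sub_le_of_deriv2 (hasDerivAt_kavg_line hu c1 t1 (N + 1) ht z (y - z))
    (hasDerivAt_kavg_line hu c2 t2 (N + 2) ht z (y - z)) (b := b) (fun s hs => hb _ (by
      rw [segment_eq_image']
      exact ⟨s, hs, rfl⟩))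
  simpa [kHess] using this

variable {M : ℝ} {Ω : Set (EuclideanSpace ℝ (Fin N))} {u : EuclideanSpace ℝ (Fin N) → ℝ}

/-- Kernel bounds in the form in which they are used. -/
def KernelBound (N : ℕ) (K : ℝ) : Prop := 0 < K ∧
    ∀ κ ∈ ({rhoKernel N, thetaKernel N} : Set (EuclideanSpace ℝ (Fin N) → ℝ)),
    ∀ y v₁ v₂ v₃ : EuclideanSpace ℝ (Fin N), |κ y| ≤ K ∧ |dirDeriv v₁ κ y| ≤ K * ‖v₁‖ ∧
      |dirDeriv v₂ (dirDeriv v₁ κ) y| ≤ K * (‖v₁‖ * ‖v₂‖) ∧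
      |dirDeriv v₃ (dirDeriv v₂ (dirDeriv v₁ κ)) y| ≤ K * (‖v₁‖ * ‖v₂‖ * ‖v₃‖)

theorem MemP.dirDeriv_eq_zero {z : 𝔼} {r : ℝ} (h : MemP N r z M Ω u) {y : 𝔼} (hy : y ∈ ball z r)
    (hΩ : y ∉ Ω) (v : 𝔼) : dirDeriv v u y = 0 := by
  have h1 : gradient u y = 0 := (h.2.2.2.1 y ⟨hy, hΩ⟩).2
  have h2 : fderiv ℝ u y = 0 := by
    rw [gradient] at h1
    simpa using h1
  rw [dirDeriv, h2]
  rfl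

theorem smallIn_one (A : Set 𝔼) (z : 𝔼) (r : ℝ) {D : ℝ} (hD : volume.real (ball (0 : 𝔼) 1) ≤ D) :
    SmallIn A z r D 1 := by
  intro y t ht htr _
  have h1 := volume_real_inter_closedBall_le A y ht.le
  have h2 : t ^ 2 ≤ (1 * r) ^ 2 := by
    rw [one_mul]
    gcongr
  have h3 : (0 : ℝ) ≤ volume.real (ball (0 : 𝔼) 1) := measureReal_nonneg
  calc volume.real (A ∩ closedBall y t) * t ^ 2
      ≤ (D * t ^ N) * (1 * r) ^ 2 := by
        have := h3.trans hD
        gcongr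
        exact h1.trans (by gcongr)
    _ = _ := by ring

theorem MemP.abs_kavg_sub_dirDeriv_le_of_smallIn (h : MemP N 1 0 M Ω u) {K D δ r : ℝ}
    (hK : KernelBound N K) (hD : volume.real (ball (0 : 𝔼) 1) ≤ D) (hδ : 0 < δ) (hr : 0 < r)
    {z : 𝔼} (hz : closedBall z r ⊆ ball 0 1) (hs : SmallIn Ωᶜ z r D δ) {x : 𝔼} {t : ℝ}
    (ht : 0 < t) (hx : dist x z + t ≤ r) (v : 𝔼) :
    |kavg u (dirDeriv v (rhoKernel N)) (N + 1) t x - (∫ y, rhoKernel N y) * dirDeriv v u x| ≤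
      4 * K * D * δ * r * ‖v‖ := by
  have hsub : ∀ s ≤ t, closedBall x s ⊆ closedBall z r := fun s hs =>
    closedBall_subset_closedBall' (by linarith)
  have := h.abs_kavg_sub_dirDeriv_le (B := K) (fun v y => (hK.2 _ (by simp) y v v v).2.1) ht
    ((hsub t le_rfl).trans hz) hK.1.le (mul_pos hδ hr)
    (D := D) (fun s hs0 hst => (volume_real_inter_closedBall_le _ _ hs0.le).trans (by gcongr))
    (fun s hs0 hst => hs x s hs0 (by linarith [dist_nonneg (x := x) (y := z)]) (hsub s hst)) v
  refine this.trans_eq ?_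
  ring

theorem MemP.taylorBounds_step (h : MemP N 1 0 M Ω u) {K D δ r d : ℝ} (hK : KernelBound N K)
    (hD : volume.real (ball (0 : 𝔼) 1) ≤ D) (hδ : 0 < δ) (hδ1 : δ ≤ 1) (hr : 0 < r) (hd : 0 ≤ d)
    {z : 𝔼} (hzΩ : z ∉ Ω) (hz : closedBall z r ⊆ ball 0 1) (hs : SmallIn Ωᶜ z r D δ)
    (hT : ∀ x ∈ closedBall z (r / 2), ∀ v w q,
      |kThird u (r / 2) x v w q| ≤ d / r * (‖v‖ * ‖w‖ * ‖q‖)) :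
    TaylorBounds u Ωᶜ z (r / 2) ((64 * K * D + 1) * (d + δ)) (d / 2 + (64 * K * D + 1) * δ) ∧
      ∀ v w, |kHess u (r / 2) z v w - kHess u r z v w| ≤
        (64 * K * D + 1) * δ * (‖v‖ * ‖w‖) := by
  have hK0 := hK.1
  have hD0 : 0 ≤ D := measureReal_nonneg.trans hD
  have hδ2 : δ ^ 2 ≤ δ := by nlinarith
  have hKD : 0 ≤ K * D := by positivity
  refine ⟨⟨fun y hy hyr v => ?_, fun x hx v w q => ?_⟩, fun v w => ?_⟩
  · rw [mem_closedBall] at hyr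
    have e1 := h.abs_kavg_sub_dirDeriv_le_of_smallIn hK hD hδ hr hz hs (x := y) (t := r / 2)
      (by positivity) (by linarith) v
    have e2 := h.abs_kavg_sub_dirDeriv_le_of_smallIn hK hD hδ hr hz hs (x := z) (t := r / 2)
      (by positivity) (by rw [dist_self]; linarith) v
    rw [h.dirDeriv_eq_zero (hz (mem_closedBall.2 (by linarith))) hy v, mul_zero, sub_zero] at e1
    rw [h.dirDeriv_eq_zero (hz (mem_closedBall_self hr.le)) hzΩ v, mul_zero, sub_zero] at e2
    have e3 := abs_kavg_taylor_le (N := N) h.2.1.continuous (t := r / 2) (by positivity) z y v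
      (b := d / r * (‖v‖ * (r / 2) * (r / 2))) (fun x hx => by
        have hx' : x ∈ closedBall z (r / 2) := (convex_closedBall z (r / 2)).segment_subset
          (mem_closedBall_self (by positivity)) (mem_closedBall.2 hyr) hx
        refine (hT x hx' v (y - z) (y - z)).trans ?_
        rw [dist_eq_norm] at hyr
        gcongr)
    have e4 : d / r * (‖v‖ * (r / 2) * (r / 2)) = d * r / 4 * ‖v‖ := by field_simp; ring
    rw [e4] at e3
    have e5 : |kHess u (r / 2) z v (y - z)| ≤ 8 * K * D * δ * r * ‖v‖ + d * r / 4 * ‖v‖ := by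
      rw [abs_le] at *
      constructor <;> linarith [e1.1, e1.2, e2.1, e2.2, e3.1, e3.2]
    refine e5.trans ?_
    have hv := norm_nonneg v
    have : 8 * K * D * δ * r + d * r / 4 ≤ (64 * K * D + 1) * (d + δ) * (r / 2) := by
      have p1 : 0 ≤ K * D * δ * r := by positivity
      have p2 : 0 ≤ K * D * d * r := by positivity
      have p3 : 0 ≤ δ * r := by positivity
      have p4 : 0 ≤ d * r := by positivity
      nlinarith
    nlinarith
  · have hxz : dist x z ≤ r / 4 := by
      rw [mem_closedBall] at hx
      linarith
    have hx' : x ∈ closedBall z (r / 2) := mem_closedBall.2 (by linarith)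
    have hsub : ∀ s ≤ r / 2, closedBall x s ⊆ closedBall z r := fun s hs =>
      closedBall_subset_closedBall' (by linarith)
    have hp := ((kernelPair_rho_theta (N := N)).dirDeriv v).dirDeriv w
    have e1 := h.abs_kavg_sub_le_of_const (hp.dirDeriv q)
      (integral_dirDeriv_eq_zero hp.contDiff_right hp.tsupport_right q)
      (B := K * (‖v‖ * ‖w‖ * ‖q‖)) (fun y => (hK.2 _ (by simp) y v w q).2.2.2)
      (x := x) (s := r / 4) (t := r / 2) (by positivity) (by linarith) ((hsub _ le_rfl).trans hz)
      (D := K * (‖v‖ * ‖w‖ * ‖q‖) * (256 * D * δ / r ^ 2)) (fun s hs1 hs2 => by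
        have hs0 : 0 < s := by linarith
        gcongr
        have e := hs x s hs0 (by linarith) (hsub s hs2)
        rw [inv_mul_le_iff₀ (by positivity)]
        have p : r ^ 4 ≤ 256 * s ^ 4 := by
          calc r ^ 4 = 256 * (r / 4) ^ 4 := by ring
            _ ≤ 256 * s ^ 4 := by gcongr
        have e' : volume.real (Ωᶜ ∩ closedBall x s) ≤ D * (δ * r) ^ 2 * s ^ N / s ^ 2 := by
          rwa [le_div_iff₀ (by positivity)]
        refine e'.trans ?_
        rw [div_le_iff₀ (by positivity)]
        calc D * (δ * r) ^ 2 * s ^ N = D * s ^ N * δ ^ 2 * (r ^ 4 / r ^ 2) := by field_simp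
          _ ≤ D * s ^ N * δ * (256 * s ^ 4 / r ^ 2) := by gcongr
          _ = s ^ (N + 2) * (256 * D * δ / r ^ 2) * s ^ 2 := by ring)
    have e2 := hT x hx' v w q
    rw [kThird] at e2
    have e3 : |kThird u (r / 2 / 2) x v w q| ≤ d / r * (‖v‖ * ‖w‖ * ‖q‖) +
        K * (‖v‖ * ‖w‖ * ‖q‖) * (256 * D * δ / r ^ 2) * (r / 2 - r / 4) := by
      rw [kThird, show r / 2 / 2 = r / 4 by ring]
      rw [abs_le] at *
      constructor <;> linarith [e1.1, e1.2, e2.1, e2.2]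
    refine e3.trans ?_
    calc _ = (d + 64 * K * D * δ) / r * (‖v‖ * ‖w‖ * ‖q‖) := by field_simp; ring
      _ ≤ (d + 2 * ((64 * K * D + 1) * δ)) / r * (‖v‖ * ‖w‖ * ‖q‖) := by
        refine mul_le_mul_of_nonneg_right (div_le_div_of_nonneg_right ?_ hr.le) (by positivity)
        nlinarith [mul_nonneg hKD hδ.le]
      _ = _ := by field_simp
  · have hsub : ∀ s ≤ r, closedBall z s ⊆ closedBall z r := fun s hs =>
      closedBall_subset_closedBall hs
    have hp := (kernelPair_rho_theta (N := N)).dirDeriv v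
    have e1 := h.abs_kavg_sub_le_of_const (hp.dirDeriv w)
      (integral_dirDeriv_eq_zero hp.contDiff_right hp.tsupport_right w)
      (B := K * (‖v‖ * ‖w‖)) (fun y => (hK.2 _ (by simp) y v w w).2.2.1)
      (x := z) (s := r / 2) (t := r) (by positivity) (by linarith) hz
      (D := K * (‖v‖ * ‖w‖) * (8 * D * δ / r)) (fun s hs1 hs2 => by
        have hs0 : 0 < s := by linarith
        gcongr
        have e := hs z s hs0 hs2 (hsub s hs2)
        rw [inv_mul_le_iff₀ (by positivity)]
        have p : r ^ 3 ≤ 8 * s ^ 3 := by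
          calc r ^ 3 = 8 * (r / 2) ^ 3 := by ring
            _ ≤ 8 * s ^ 3 := by gcongr
        have e' : volume.real (Ωᶜ ∩ closedBall z s) ≤ D * (δ * r) ^ 2 * s ^ N / s ^ 2 := by
          rwa [le_div_iff₀ (by positivity)]
        refine e'.trans ?_
        rw [div_le_iff₀ (by positivity)]
        calc D * (δ * r) ^ 2 * s ^ N = D * s ^ N * δ ^ 2 * (r ^ 3 / r) := by field_simp
          _ ≤ D * s ^ N * δ * (8 * s ^ 3 / r) := by gcongr
          _ = s ^ (N + 1) * (8 * D * δ / r) * s ^ 2 := by ring)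
    rw [abs_sub_comm, kHess, kHess]
    refine e1.trans ?_
    calc _ = 4 * K * D * δ * (‖v‖ * ‖w‖) := by field_simp; ring
      _ ≤ _ := by
        gcongr
        nlinarith

end DyadicStep

section SlabCriterion

variable {N : ℕ}

local notation "𝔼" => EuclideanSpace ℝ (Fin N)

/-- A large symmetric operator with bounded trace has two large eigenvalues. -/
theorem LinearMap.IsSymmetric.exists_two_large_eigenvalues {T : 𝔼 →ₗ[ℝ] 𝔼} (hT : T.IsSymmetric)
    {c τ : ℝ} (htr : |∑ i, ⟪EuclideanSpace.single i 1, T (EuclideanSpace.single i 1)⟫| ≤ c)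
    (hτ : 2 * c ≤ τ) (hτ0 : 0 < τ) (hbig : ¬ ∀ v w, |⟪v, T w⟫| ≤ τ * (‖v‖ * ‖w‖)) :
    ∃ (b : OrthonormalBasis (Fin N) ℝ 𝔼) (i j : Fin N), i ≠ j ∧
      (∀ y, τ / (2 * N) * |⟪b i, y⟫| ≤ |⟪b i, T y⟫|) ∧
      ∀ y, τ / (2 * N) * |⟪b j, y⟫| ≤ |⟪b j, T y⟫| := by
  have hn : Module.finrank ℝ 𝔼 = N := by simp
  set b := hT.eigenvectorBasis hn with hb
  set l := hT.eigenvalues hn with hl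
  have hbT : ∀ i y, ⟪b i, T y⟫ = l i * ⟪b i, y⟫ := by
    intro i y
    rw [← hT (b i) y, hb, hT.apply_eigenvectorBasis hn i, real_inner_smul_left]
    rfl
  obtain ⟨i, hi⟩ : ∃ i, τ < |l i| := by
    by_contra! hle
    apply hbig
    intro v w
    have h1 : ‖T w‖ ^ 2 ≤ (τ * ‖w‖) ^ 2 := by
      rw [← b.sum_sq_norm_inner_right, mul_pow, ← b.sum_sq_norm_inner_right w, Finset.mul_sum]
      refine Finset.sum_le_sum fun i _ => ?_
      rw [hbT, norm_mul, mul_pow]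
      gcongr
      exact hle i
    have h2 : ‖T w‖ ≤ τ * ‖w‖ := (sq_le_sq₀ (norm_nonneg _) (by positivity)).1 h1
    calc |⟪v, T w⟫| ≤ ‖v‖ * ‖T w‖ := abs_real_inner_le_norm _ _
      _ ≤ ‖v‖ * (τ * ‖w‖) := by gcongr
      _ = _ := by ring
  have htr2 : ∑ i, ⟪EuclideanSpace.single i 1, T (EuclideanSpace.single i 1)⟫ = ∑ i, l i := by
    have h1 := LinearMap.trace_eq_sum_inner T (EuclideanSpace.basisFun (Fin N) ℝ)
    rw [LinearMap.trace_eq_sum_inner T b] at h1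
    simp only [EuclideanSpace.basisFun_apply] at h1
    rw [← h1]
    refine Finset.sum_congr rfl fun i _ => ?_
    rw [hbT, real_inner_self_eq_norm_sq, b.norm_eq_one]
    simp
  rw [htr2] at htr
  have hN : (0 : ℝ) < N := by
    have := i.pos
    exact_mod_cast this
  obtain ⟨j, hj, hj2⟩ : ∃ j, i ≠ j ∧ τ / (2 * N) ≤ |l j| := by
    by_contra! hle
    have h1 : |∑ j ∈ Finset.univ.erase i, l j| ≤ ∑ j ∈ (Finset.univ : Finset (Fin N)).erase i,
        τ / (2 * N) :=
      (Finset.abs_sum_le_sum_abs _ _).trans (Finset.sum_le_sum fun j hj =>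
        (hle j (Finset.ne_of_mem_erase hj).symm).le)
    rw [Finset.sum_const, Finset.card_erase_of_mem (Finset.mem_univ i), Finset.card_univ,
      Fintype.card_fin, nsmul_eq_mul] at h1
    have h2 : ((N - 1 : ℕ) : ℝ) ≤ N := by exact_mod_cast Nat.sub_le N 1
    have h3 : ((N - 1 : ℕ) : ℝ) * (τ / (2 * N)) ≤ τ / 2 := by
      calc _ ≤ (N : ℝ) * (τ / (2 * N)) := by gcongr
        _ = τ / 2 := by field_simp
    rw [← Finset.add_sum_erase _ _ (Finset.mem_univ i)] at htr
    have h4 := abs_sub_abs_le_abs_sub (l i) (-∑ j ∈ Finset.univ.erase i, l j)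
    rw [abs_neg, sub_neg_eq_add] at h4
    linarith
  refine ⟨b, i, j, hj, fun y => ?_, fun y => ?_⟩
  · rw [hbT, abs_mul]
    have h1 : τ / (2 * N) ≤ |l i| := by
      refine le_trans ?_ hi.le
      have : (1 : ℝ) ≤ N := by exact_mod_cast i.pos
      rw [div_le_iff₀ (by positivity)]
      nlinarith
    gcongr
  · rw [hbT, abs_mul]
    gcongr

theorem volume_real_inter_closedBall_le_of_slab (b : OrthonormalBasis (Fin N) ℝ 𝔼) {i j : Fin N}
    (hij : i ≠ j) {S : Set 𝔼} {z : 𝔼} {σ : ℝ} (hi : ∀ y ∈ S, |⟪b i, y - z⟫| ≤ σ)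
    (hj : ∀ y ∈ S, |⟪b j, y - z⟫| ≤ σ) (x : 𝔼) {t : ℝ} (ht : 0 < t) (hσ : 0 ≤ σ) :
    volume.real (S ∩ closedBall x t) * t ^ 2 ≤ 2 ^ N * σ ^ 2 * t ^ N := by
  set w : Fin N → ℝ := fun l => if l = i ∨ l = j then σ else t with hw
  set p : Fin N → ℝ := fun l => if l = i ∨ l = j then ⟪b l, z⟫ else ⟪b l, x⟫ with hp
  have hmp := (PiLp.volume_preserving_ofLp (Fin N)).comp b.measurePreserving_repr
  have hw0 : ∀ l, 0 ≤ w l := by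
    intro l
    simp only [hw]
    split_ifs <;> positivity
  have hsub : S ∩ closedBall x t ⊆ (WithLp.ofLp ∘ b.repr) ⁻¹'
      Icc (fun l => p l - w l) (fun l => p l + w l) := by
    rintro y ⟨hyS, hyx⟩
    have key : ∀ l, |⟪b l, y⟫ - p l| ≤ w l := by
      intro l
      simp only [hp, hw]
      split_ifs with h
      · rw [← inner_sub_right]
        rcases h with rfl | rfl
        · exact hi y hyS
        · exact hj y hyS
      · rw [← inner_sub_right]
        refine (abs_real_inner_le_norm _ _).trans ?_
        rw [b.norm_eq_one, one_mul, ← dist_eq_norm]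
        exact hyx
    constructor
    · intro l
      have := abs_le.1 (key l)
      simp only [Function.comp_apply, b.repr_apply_apply]
      linarith [this.1]
    · intro l
      have := abs_le.1 (key l)
      simp only [Function.comp_apply, b.repr_apply_apply]
      linarith [this.2]
  have hvol : volume.real ((WithLp.ofLp ∘ b.repr) ⁻¹'
      Icc (fun l => p l - w l) (fun l => p l + w l)) = ∏ l, (2 * w l) := by
    rw [hmp.measureReal_preimage measurableSet_Icc.nullMeasurableSet, measureReal_def,
      Real.volume_Icc_pi_toReal fun l => by linarith [hw0 l]]
    refine Finset.prod_congr rfl fun l _ => ?_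
    ring
  have hprod : (∏ l, (2 * w l)) * t ^ 2 = 2 ^ N * σ ^ 2 * t ^ N := by
    have hj' : j ∈ Finset.univ.erase i := Finset.mem_erase.2 ⟨hij.symm, Finset.mem_univ j⟩
    have h3 : ∏ l ∈ (Finset.univ.erase i).erase j, w l = t ^ (N - 2) := by
      have : ∏ l ∈ (Finset.univ.erase i).erase j, w l =
          ∏ l ∈ ((Finset.univ : Finset (Fin N)).erase i).erase j, t := by
        refine Finset.prod_congr rfl fun l hl => ?_
        simp only [Finset.mem_erase] at hl
        simp [hw, hl.1, hl.2.1]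
      rw [this, Finset.prod_const, Finset.card_erase_of_mem hj',
        Finset.card_erase_of_mem (Finset.mem_univ i), Finset.card_univ, Fintype.card_fin,
        Nat.sub_sub]
    have hN : 2 ≤ N := by
      have := i.isLt
      have := j.isLt
      have : (i : ℕ) ≠ j := fun h => hij (Fin.ext h)
      omega
    rw [Finset.prod_mul_distrib, Finset.prod_const, Finset.card_univ, Fintype.card_fin,
      ← Finset.mul_prod_erase _ _ (Finset.mem_univ i), ← Finset.mul_prod_erase _ _ hj', h3]
    have h4 : t ^ N = t ^ (N - 2) * t ^ 2 := by
      rw [← pow_add]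
      congr 1
      omega
    rw [h4]
    simp only [hw, true_or, or_true, if_true]
    ring
  rw [← hprod, ← hvol]
  refine mul_le_mul_of_nonneg_right (measureReal_mono hsub ?_) (by positivity)
  rw [hmp.measure_preimage measurableSet_Icc.nullMeasurableSet]
  exact isCompact_Icc.measure_lt_top.ne

/-- The averaged Hessian is represented by a symmetric operator. -/
theorem exists_symmetric_kHess {u : 𝔼 → ℝ} (hu : Continuous u) {t : ℝ} (ht : 0 < t) (x : 𝔼) :
    ∃ T : 𝔼 →ₗ[ℝ] 𝔼, T.IsSymmetric ∧ ∀ v w, ⟪v, T w⟫ = kHess u t x v w := by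
  set U := kavg u (rhoKernel N) N t with hU
  have hUs : ContDiff ℝ ∞ U := contDiff_kavg hu contDiff_rhoKernel tsupport_rhoKernel N ht
  have hH : ∀ v w, kHess u t x v w = dirDeriv w (dirDeriv v U) x := by
    intro v w
    rw [hU, dirDeriv_kavg hu contDiff_rhoKernel tsupport_rhoKernel N ht v,
      dirDeriv_kavg hu (contDiff_dirDeriv contDiff_rhoKernel v)
        ((tsupport_dirDeriv_subset _ v).trans tsupport_rhoKernel) (N + 1) ht w]
    rfl
  have hF : ∀ v w, dirDeriv w (dirDeriv v U) x = fderiv ℝ (fderiv ℝ U) x w v := by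
    intro v w
    have e : dirDeriv v U = fun y => fderiv ℝ U y v := rfl
    rw [e, dirDeriv, fderiv_clm_apply ((hUs.fderiv_right (m := ∞) (by simp)).differentiable
      (by simp) x) (differentiableAt_const v)]
    simp
  have hT : ∀ v w, ⟪v, ((InnerProductSpace.toDual ℝ 𝔼).symm.toLinearEquiv.toLinearMap ∘ₗ
      (fderiv ℝ (fderiv ℝ U) x).toLinearMap) w⟫ = kHess u t x v w := by
    intro v w
    rw [hH, hF, real_inner_comm]
    exact InnerProductSpace.toDual_symm_apply
  refine ⟨_, fun v w => ?_, hT⟩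
  rw [real_inner_comm, hT, hT, hH, hH, dirDeriv_comm hUs]

variable {M : ℝ} {Ω : Set (EuclideanSpace ℝ (Fin N))} {u : EuclideanSpace ℝ (Fin N) → ℝ}

theorem MemP.trace_kHess_eq (h : MemP N 1 0 M Ω u) {x : 𝔼} {t : ℝ} (ht : 0 < t)
    (hx : closedBall x t ⊆ ball 0 1) :
    ∑ i, kHess u t x (EuclideanSpace.single i 1) (EuclideanSpace.single i 1) =
      (t ^ N)⁻¹ * ∫ z in Ω, rhoKernel N (t⁻¹ • (x - z)) := by
  have hcont : ∀ i : Fin N, Integrable (fun z => u z * dirDeriv (EuclideanSpace.single i 1)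
      (dirDeriv (EuclideanSpace.single i 1) (rhoKernel N)) (t⁻¹ • (x - z))) := by
    intro i
    have hc := (contDiff_dirDeriv (contDiff_dirDeriv (contDiff_rhoKernel (N := N))
      (EuclideanSpace.single i 1)) (EuclideanSpace.single i 1)).continuous
    have hs := (tsupport_dirDeriv_subset (dirDeriv (EuclideanSpace.single i 1) (rhoKernel N))
      (EuclideanSpace.single i 1)).trans
      ((tsupport_dirDeriv_subset _ (EuclideanSpace.single i 1)).trans tsupport_rhoKernel)
    have hu := h.2.1.continuous
    exact Continuous.integrable_of_hasCompactSupport (by fun_prop)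
      (hasCompactSupport_kernel hs ht x).mul_left
  simp only [kHess, kavg]
  rw [← Finset.mul_sum, ← integral_finsetSum _ fun i _ => hcont i]
  simp only [← Finset.mul_sum]
  have h1 := h.integral_lap_kernel contDiff_rhoKernel tsupport_rhoKernel ht hx
  simp only [lap_eq_sum] at h1
  rw [h1]
  field_simp
  ring

theorem MemP.abs_trace_kHess_le (h : MemP N 1 0 M Ω u) {x : 𝔼} {t : ℝ} (ht : 0 < t)
    (hx : closedBall x t ⊆ ball 0 1) :
    |∑ i, kHess u t x (EuclideanSpace.single i 1) (EuclideanSpace.single i 1)| ≤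
      ∫ y, rhoKernel N y := by
  have hρ : Integrable fun z => rhoKernel N (t⁻¹ • (x - z)) := by
    have := (contDiff_rhoKernel (N := N)).continuous
    exact Continuous.integrable_of_hasCompactSupport (by fun_prop)
      (hasCompactSupport_kernel tsupport_rhoKernel ht x)
  have h2 : ∫ z in Ω, rhoKernel N (t⁻¹ • (x - z)) ≤ ∫ z, rhoKernel N (t⁻¹ • (x - z)) :=
    setIntegral_le_integral hρ (Eventually.of_forall fun z => rhoKernel_nonneg _)
  have h3 : 0 ≤ ∫ z in Ω, rhoKernel N (t⁻¹ • (x - z)) :=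
    integral_nonneg fun z => rhoKernel_nonneg _
  rw [integral_comp_kernel _ ht] at h2
  rw [h.trace_kHess_eq ht hx, abs_of_nonneg (by positivity), inv_mul_le_iff₀ (by positivity)]
  exact h2

/-- If the averaged Hessian is large, the coincidence set is trapped near a subspace of
codimension two. -/
theorem MemP.smallIn_of_kHess_large (h : MemP N 1 0 M Ω u) {z : 𝔼} {r : ℝ} (hr : 0 < r)
    (hz : closedBall z r ⊆ ball 0 1) {η τ D : ℝ} (hη : 0 ≤ η) (hD : 2 ^ N ≤ D) (hτ0 : 0 < τ)
    (hτ : 2 * ∫ y, rhoKernel N y ≤ τ)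
    (hflat : ∀ y ∈ Ωᶜ, y ∈ closedBall z r → ∀ v, |kHess u r z v (y - z)| ≤ η * r * ‖v‖)
    (hbig : ¬ ∀ v w, |kHess u r z v w| ≤ τ * (‖v‖ * ‖w‖)) :
    SmallIn Ωᶜ z r D (2 * N * η / τ) := by
  obtain ⟨T, hT, hTH⟩ := exists_symmetric_kHess h.2.1.continuous hr z
  have htr := h.abs_trace_kHess_le hr hz
  simp only [← hTH] at htr hbig hflat
  obtain ⟨b, i, j, hij, hi, hj⟩ := hT.exists_two_large_eigenvalues htr hτ hτ0 hbig
  have hN : (0 : ℝ) < N := by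
    have := i.pos
    exact_mod_cast this
  have key : ∀ i : Fin N, (∀ y, τ / (2 * N) * |⟪b i, y⟫| ≤ |⟪b i, T y⟫|) →
      ∀ y ∈ Ωᶜ ∩ closedBall z r, |⟪b i, y - z⟫| ≤ 2 * N * η / τ * r := by
    intro i hi y hy
    have h1 := (hi (y - z)).trans (hflat y hy.1 hy.2 (b i))
    rw [b.norm_eq_one, mul_one] at h1
    rw [div_mul_eq_mul_div, div_le_iff₀ (by positivity)] at h1
    rw [div_mul_eq_mul_div, le_div_iff₀ hτ0]
    linarith
  intro y t ht _ hsub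
  have h1 := volume_real_inter_closedBall_le_of_slab b hij (key i hi) (key j hj) y ht
    (by positivity)
  rw [inter_assoc, inter_eq_self_of_subset_right hsub] at h1
  refine h1.trans ?_
  gcongr

end SlabCriterion

section QuadraticGrowth

variable {N : ℕ}

local notation "𝔼" => EuclideanSpace ℝ (Fin N)

variable {M : ℝ} {Ω : Set (EuclideanSpace ℝ (Fin N))} {u : EuclideanSpace ℝ (Fin N) → ℝ}

theorem TaylorBounds.mono {A : Set 𝔼} {z : 𝔼} {r η d η' d' : ℝ} (hr : 0 < r)
    (h : TaylorBounds u A z r η d) (hη : η ≤ η') (hd : d ≤ d') : TaylorBounds u A z r η' d' := by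
  refine ⟨fun y hy hyr v => (h.1 y hy hyr v).trans ?_, fun x hx v w q => (h.2 x hx v w q).trans ?_⟩
  · gcongr
  · gcongr

theorem MemP.dyadic_bounds (h : MemP N 1 0 M Ω u) {K D r₀ C₁ C₀ L τ : ℝ} (hK : KernelBound N K)
    (hD : volume.real (ball (0 : 𝔼) 1) ≤ D) (hD2 : 2 ^ N ≤ D) (hr₀ : 0 < r₀)
    {z : 𝔼} (hzΩ : z ∉ Ω) (hz : closedBall z r₀ ⊆ ball 0 1) (hC₁ : C₁ = 64 * K * D + 1)
    (hC₀ : 2 * C₁ ≤ C₀) (hL : 4 * C₁ ≤ L) (hτ1 : 8 * N * L * C₁ ≤ τ) (hτ2 : 2 * N * L * C₀ ≤ τ)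
    (hτ3 : 2 * ∫ y, rhoKernel N y ≤ τ) (hτ0 : 0 < τ) (hN : 0 < N)
    (hbase : TaylorBounds u Ωᶜ z r₀ (L * C₀) C₀)
    (hbase2 : ∀ v w, |kHess u r₀ z v w| ≤ τ * (‖v‖ * ‖w‖)) (k : ℕ) :
    ∃ d, 0 < d ∧ d ≤ C₀ ∧ TaylorBounds u Ωᶜ z (r₀ * (1 / 2) ^ k) (L * d) d ∧
      ∀ v w, |kHess u (r₀ * (1 / 2) ^ k) z v w| ≤ (τ + C₁ + C₀ - d) * (‖v‖ * ‖w‖) := by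
  have hD0 : 0 ≤ D := measureReal_nonneg.trans hD
  have hK0 := hK.1
  have hC₁1 : 1 ≤ C₁ := by
    have : 0 ≤ K * D := by positivity
    linarith
  have hN' : (0 : ℝ) < N := by exact_mod_cast hN
  induction k with
  | zero =>
    refine ⟨C₀, by linarith, le_rfl, by simpa using hbase, fun v w => ?_⟩
    rw [pow_zero, mul_one]
    refine (hbase2 v w).trans ?_
    gcongr
    linarith
  | succ k ih =>
    obtain ⟨d, hd0, hdC, hT, hH⟩ := ih
    set r := r₀ * (1 / 2) ^ k with hr
    have hr0 : 0 < r := by positivity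
    have hrr : r ≤ r₀ := mul_le_of_le_one_right hr₀.le (pow_le_one₀ (by norm_num) (by norm_num))
    have hzr : closedBall z r ⊆ ball 0 1 := (closedBall_subset_closedBall hrr).trans hz
    have hr2 : r₀ * (1 / 2) ^ (k + 1) = r / 2 := by rw [hr]; ring
    rw [hr2]
    have hL0 : 0 < L := by linarith
    by_cases hbig : ∀ v w, |kHess u r z v w| ≤ τ * (‖v‖ * ‖w‖)
    · obtain ⟨s1, s2⟩ := h.taylorBounds_step hK hD one_pos le_rfl hr0 hd0.le hzΩ hzr
        (smallIn_one _ _ _ hD) hT.2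
      rw [← hC₁] at s1 s2
      refine ⟨C₀, by linarith, le_rfl, s1.mono (by positivity) ?_ (by linarith), fun v w => ?_⟩
      · nlinarith
      · have h1 := s2 v w
        have h2 := hbig v w
        have h3 : |kHess u (r / 2) z v w| ≤ τ * (‖v‖ * ‖w‖) + C₁ * 1 * (‖v‖ * ‖w‖) := by
          rw [abs_le] at *
          constructor <;> linarith [h1.1, h1.2, h2.1, h2.2]
        refine h3.trans_eq ?_
        ring
    · set δ := 2 * N * (L * d) / τ with hδ
      have hδ0 : 0 < δ := by positivity
      have hsm := h.smallIn_of_kHess_large hr0 hzr (by positivity) hD2 hτ0 hτ3 hT.1 hbig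
      rw [← hδ] at hsm
      have hδ1 : δ ≤ 1 := by
        rw [hδ, div_le_one hτ0]
        calc 2 * N * (L * d) = 2 * N * L * d := by ring
          _ ≤ 2 * N * L * C₀ := by gcongr
          _ ≤ τ := hτ2
      have hδd : C₁ * δ ≤ d / 4 := by
        rw [hδ, mul_div_assoc', div_le_iff₀ hτ0]
        nlinarith
      obtain ⟨s1, s2⟩ := h.taylorBounds_step hK hD hδ0 hδ1 hr0 hd0.le hzΩ hzr hsm hT.2
      rw [← hC₁] at s1 s2
      refine ⟨3 / 4 * d, by linarith, by linarith, s1.mono (by positivity) ?_ (by linarith),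
        fun v w => ?_⟩
      · nlinarith
      · have h1 := s2 v w
        have h2 := hH v w
        have h3 : |kHess u (r / 2) z v w| ≤ (τ + C₁ + C₀ - d) * (‖v‖ * ‖w‖) +
            C₁ * δ * (‖v‖ * ‖w‖) := by
          rw [abs_le] at *
          constructor <;> linarith [h1.1, h1.2, h2.1, h2.2]
        refine h3.trans ?_
        rw [← add_mul]
        gcongr
        linarith

theorem exists_quadratic_growth (hN : 0 < N) {M : ℝ} (hM : 0 < M) :
    ∃ C : ℝ, 0 < C ∧ ∀ (Ω : Set 𝔼) (u : 𝔼 → ℝ), MemP N 1 0 M Ω u → ∀ z ∉ Ω, ‖z‖ ≤ 3 / 4 →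
      ∀ x, dist x z ≤ 1 / 16 → ∀ v, |dirDeriv v u x| ≤ C * dist x z * ‖v‖ := by
  obtain ⟨K, hK⟩ := exists_kernel_bounds N
  have hK : KernelBound N K := hK
  have hK0 := hK.1
  obtain ⟨V₀, hV⟩ : ∃ a, a = volume.real (ball (0 : 𝔼) 1) := ⟨_, rfl⟩
  have hV0 : 0 ≤ V₀ := hV ▸ measureReal_nonneg
  obtain ⟨c, hc⟩ : ∃ a, a = ∫ y, rhoKernel N y := ⟨_, rfl⟩
  have hc0 : 0 < c := hc ▸ integral_rhoKernel_pos hN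
  obtain ⟨D, hDdef⟩ : ∃ a, a = 2 ^ N + V₀ := ⟨_, rfl⟩
  have hD0 : 0 < D := by rw [hDdef]; positivity
  obtain ⟨C₁, hC₁⟩ : ∃ a, a = 64 * K * D + 1 := ⟨_, rfl⟩
  have hC₁0 : 0 < C₁ := by rw [hC₁]; positivity
  obtain ⟨X, hX⟩ : ∃ a, a = (((1 : ℝ) / 8) ^ (N + 2))⁻¹ * (M * K * V₀) := ⟨_, rfl⟩
  obtain ⟨Y, hY⟩ : ∃ a, a = (((1 : ℝ) / 8 / 2) ^ (N + 3))⁻¹ * (M * K * V₀) := ⟨_, rfl⟩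
  have hX0 : 0 ≤ X := by rw [hX]; positivity
  have hY0 : 0 ≤ Y := by rw [hY]; positivity
  obtain ⟨C₀, hC₀⟩ : ∃ a, a = 2 * C₁ + X + Y := ⟨_, rfl⟩
  obtain ⟨L, hL⟩ : ∃ a, a = 4 * C₁ := ⟨_, rfl⟩
  obtain ⟨τ, hτ⟩ : ∃ a, a = 8 * N * L * C₁ + 2 * N * L * C₀ + 2 * c + X := ⟨_, rfl⟩
  have hN' : (0 : ℝ) < N := by exact_mod_cast hN
  have hC₀0 : 0 < C₀ := by rw [hC₀]; positivity
  have hL0 : 0 < L := by rw [hL]; positivity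
  have p1 : 0 < N * L * C₁ := by positivity
  have p2 : 0 < N * L * C₀ := by positivity
  have hτ0 : 0 < τ := by rw [hτ]; positivity
  have hVD : volume.real (ball (0 : 𝔼) 1) ≤ D := by
    rw [hDdef, ← hV]
    exact le_add_of_nonneg_left (by positivity)
  have h2D : 2 ^ N ≤ D := by
    rw [hDdef]
    exact le_add_of_nonneg_right hV0
  have hXL : X ≤ L * C₀ := by
    refine (show X ≤ C₀ by linarith).trans (le_mul_of_one_le_left hC₀0.le ?_)
    have : 0 ≤ K * D := by positivity
    linarith
  refine ⟨c⁻¹ * (16 * K * D + 2 * C₀ + 2 * (τ + C₁ + C₀)) * 2, by positivity,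
    fun Ω u h z hzΩ hz x hx v => ?_⟩
  have hzr : closedBall z (1 / 8) ⊆ ball 0 1 := by
    refine (closedBall_subset_ball' (ε₂ := 1) ?_)
    rw [dist_zero_right]
    linarith
  have hbd : ∀ {κ : 𝔼 → ℝ} (a : ℕ) {B : ℝ} {x : 𝔼} {t : ℝ}, tsupport κ ⊆ closedBall 0 1 →
      (∀ y, |κ y| ≤ B) → 0 < t → closedBall x t ⊆ ball 0 1 →
      |kavg u κ a t x| ≤ (t ^ a)⁻¹ * (M * B * V₀) := fun a _ _ _ h1 h2 h3 h4 =>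
    hV ▸ h.abs_kavg_le h1 h2 a h3 h4
  have hs1 : ∀ v : 𝔼, tsupport (dirDeriv v (rhoKernel N)) ⊆ closedBall 0 1 := fun v =>
    (tsupport_dirDeriv_subset _ v).trans tsupport_rhoKernel
  have hs2 : ∀ v w : 𝔼, tsupport (dirDeriv w (dirDeriv v (rhoKernel N))) ⊆ closedBall 0 1 :=
    fun v w => (tsupport_dirDeriv_subset _ w).trans (hs1 v)
  have hH0 : ∀ v w, |kHess u (1 / 8) z v w| ≤ X * (‖v‖ * ‖w‖) := by
    intro v w
    refine (hbd (N + 2) (hs2 v w) (fun y => (hK.2 _ (by simp) y v w w).2.2.1)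
      (by norm_num) hzr).trans_eq ?_
    rw [hX]
    ring
  have hT0 : ∀ x ∈ closedBall z (1 / 8 / 2), ∀ v w q,
      |kThird u (1 / 8 / 2) x v w q| ≤ Y * (‖v‖ * ‖w‖ * ‖q‖) := by
    intro x hx v w q
    rw [mem_closedBall] at hx
    refine (hbd (N + 3) ((tsupport_dirDeriv_subset _ q).trans (hs2 v w))
      (fun y => (hK.2 _ (by simp) y v w q).2.2.2)
      (by norm_num) ((closedBall_subset_closedBall' (by linarith)).trans hzr)).trans_eq ?_
    rw [hY]
    ring
  have hbase : TaylorBounds u Ωᶜ z (1 / 8) (L * C₀) C₀ := by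
    refine ⟨fun y _ hyr v => (hH0 v (y - z)).trans ?_, fun x hx v w q => (hT0 x hx v w q).trans ?_⟩
    · rw [mem_closedBall, dist_eq_norm] at hyr
      calc X * (‖v‖ * ‖y - z‖) ≤ L * C₀ * (‖v‖ * (1 / 8)) := by gcongr
        _ = _ := by ring
    · gcongr
      linarith
  have hdy := h.dyadic_bounds hK hVD h2D (by norm_num) hzΩ hzr hC₁
    (C₀ := C₀) (L := L) (τ := τ) (by linarith) (by linarith) (by linarith) (by linarith)
    (by linarith) hτ0 hN hbase (fun v w => (hH0 v w).trans (by gcongr; linarith))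
  rcases eq_or_ne x z with rfl | hxz
  · rw [h.dirDeriv_eq_zero (hzr (mem_closedBall_self (by norm_num))) hzΩ v, dist_self]
    simp
  have hdist : 0 < dist x z := dist_pos.2 hxz
  obtain ⟨k, hk1, hk2⟩ := exists_nat_pow_near_of_lt_one (y := (1 / 2 : ℝ))
    (x := 16 * dist x z) (by positivity) (by linarith) (by norm_num) (by norm_num)
  obtain ⟨d, hd0, hdC, hT, -⟩ := hdy k
  obtain ⟨d', hd0', -, -, hH⟩ := hdy (k + 1)
  set r : ℝ := 1 / 8 * (1 / 2) ^ k with hr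
  have hr0 : 0 < r := by positivity
  have hr2 : (1 / 8 : ℝ) * (1 / 2) ^ (k + 1) = r / 2 := by rw [hr]; ring
  rw [hr2] at hH
  have hrd : r ≤ 4 * dist x z := by
    rw [pow_succ] at hk1
    linarith
  have hdr : dist x z ≤ r / 2 := by linarith
  have hzr' : closedBall z r ⊆ ball 0 1 := by
    refine (closedBall_subset_closedBall ?_).trans hzr
    exact mul_le_of_le_one_right (by norm_num) (pow_le_one₀ (by norm_num) (by norm_num))
  have hsm := smallIn_one (D := D) Ωᶜ z r hVD
  have e1 := h.abs_kavg_sub_dirDeriv_le_of_smallIn hK (by linarith) one_pos hr0 hzr' hsm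
    (x := x) (t := r / 2) (by positivity) (by linarith) v
  have e2 := h.abs_kavg_sub_dirDeriv_le_of_smallIn hK (by linarith) one_pos hr0 hzr' hsm
    (x := z) (t := r / 2) (by positivity) (by rw [dist_self]; linarith) v
  rw [h.dirDeriv_eq_zero (hzr' (mem_closedBall_self hr0.le)) hzΩ v, mul_zero, sub_zero] at e2
  rw [← hc] at e1
  have e3 := abs_kavg_taylor_le (N := N) h.2.1.continuous (t := r / 2) (by positivity) z x v
    (b := C₀ / r * (‖v‖ * (r / 2) * (r / 2))) (fun y hy => by
      have hy' : y ∈ closedBall z (r / 2) := (convex_closedBall z (r / 2)).segment_subset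
        (mem_closedBall_self (by positivity)) (mem_closedBall.2 hdr) hy
      refine (hT.2 y hy' v (x - z) (x - z)).trans ?_
      rw [dist_eq_norm] at hdr
      gcongr)
  have e3' : C₀ / r * (‖v‖ * (r / 2) * (r / 2)) = C₀ / 4 * (r * ‖v‖) := by field_simp; ring
  rw [e3'] at e3
  have e4 : |kHess u (r / 2) z v (x - z)| ≤ (τ + C₁ + C₀) / 2 * (r * ‖v‖) := by
    refine (hH v (x - z)).trans ?_
    rw [dist_eq_norm] at hdr
    calc _ ≤ (τ + C₁ + C₀) * (‖v‖ * (r / 2)) := by gcongr; linarith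
      _ = _ := by ring
  have e5 : |c * dirDeriv v u x| ≤ (8 * K * D + C₀ / 4 + (τ + C₁ + C₀) / 2) * (r * ‖v‖) := by
    rw [abs_le] at *
    constructor <;> linarith [e1.1, e1.2, e2.1, e2.2, e3.1, e3.2, e4.1, e4.2]
  rw [abs_mul, abs_of_pos hc0] at e5
  have e6 : |dirDeriv v u x| ≤ c⁻¹ * ((8 * K * D + C₀ / 4 + (τ + C₁ + C₀) / 2) * (r * ‖v‖)) := by
    rw [le_inv_mul_iff₀ hc0]
    exact e5
  refine e6.trans ?_
  have e7 : r * ‖v‖ ≤ 4 * dist x z * ‖v‖ := mul_le_mul_of_nonneg_right hrd (norm_nonneg v)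
  have e8 : 8 * K * D + C₀ / 4 + (τ + C₁ + C₀) / 2 ≤ 8 * K * D + C₀ + (τ + C₁ + C₀) := by
    linarith
  have e9 : 0 ≤ 8 * K * D + C₀ + (τ + C₁ + C₀) := by positivity
  refine (mul_le_mul_of_nonneg_left (mul_le_mul e8 e7 (by positivity) e9)
    (inv_nonneg.2 hc0.le)).trans_eq ?_
  ring

theorem exists_gradient_bound (hN : 0 < N) {M : ℝ} (hM : 0 < M) :
    ∃ C : ℝ, 0 < C ∧ ∀ (Ω : Set 𝔼) (u : 𝔼 → ℝ), MemP N 1 0 M Ω u →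
      ∀ x, ‖x‖ ≤ 3 / 4 → ∀ v, |dirDeriv v u x| ≤ C * ‖v‖ := by
  obtain ⟨K, hK⟩ := exists_kernel_bounds N
  have hK : KernelBound N K := hK
  have hK0 := hK.1
  set V₀ := volume.real (ball (0 : 𝔼) 1) with hV
  have hV0 : 0 ≤ V₀ := measureReal_nonneg
  set c := ∫ y, rhoKernel N y with hc
  have hc0 : 0 < c := integral_rhoKernel_pos hN
  refine ⟨c⁻¹ * ((((1 : ℝ) / 8) ^ (N + 1))⁻¹ * (M * K * V₀) + 4 * K * V₀ * 1 * (1 / 8) + 1),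
    by positivity, fun Ω u h x hx v => ?_⟩
  have hxr : closedBall x (1 / 8) ⊆ ball 0 1 := by
    refine (closedBall_subset_ball' (ε₂ := 1) ?_)
    rw [dist_zero_right]
    linarith
  have e1 := h.abs_kavg_sub_dirDeriv_le_of_smallIn hK le_rfl one_pos (by norm_num) hxr
    (smallIn_one Ωᶜ x (1 / 8) le_rfl) (x := x) (t := 1 / 8) (by norm_num)
    (by rw [dist_self]; norm_num) v
  have e2 := h.abs_kavg_le ((tsupport_dirDeriv_subset _ v).trans tsupport_rhoKernel)
    (fun y => (hK.2 _ (by simp) y v v v).2.1) (N + 1) (by norm_num) hxr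
  rw [← hV] at e1 e2
  have e3 : |c * dirDeriv v u x| ≤ ((((1 : ℝ) / 8) ^ (N + 1))⁻¹ * (M * K * V₀) +
      4 * K * V₀ * 1 * (1 / 8)) * ‖v‖ := by
    rw [abs_le] at *
    constructor <;> linarith [e1.1, e1.2, e2.1, e2.2]
  rw [abs_mul, abs_of_pos hc0] at e3
  rw [mul_assoc, le_inv_mul_iff₀ hc0]
  refine e3.trans ?_
  exact mul_le_mul_of_nonneg_right (by linarith) (norm_nonneg v)

end QuadraticGrowth

section Nondegeneracy

variable {N : ℕ}

local notation "𝔼" => EuclideanSpace ℝ (Fin N)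

variable {M : ℝ} {Ω : Set (EuclideanSpace ℝ (Fin N))} {u : EuclideanSpace ℝ (Fin N) → ℝ}

theorem le_of_tendsto_of_hasDerivAt_nonneg {f f' : ℝ → ℝ} {l T : ℝ}
    (hT : 0 < T) (hf : ∀ t ∈ Ioc 0 T, HasDerivAt f (f' t) t) (hf' : ∀ t ∈ Ioc 0 T, 0 ≤ f' t)
    (hl : Tendsto f (𝓝[>] 0) (𝓝 l)) : l ≤ f T := by
  have hm : MonotoneOn f (Ioc 0 T) := by
    refine monotoneOn_of_deriv_nonneg (convex_Ioc 0 T)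
      (fun t ht => (hf t ht).continuousAt.continuousWithinAt)
      (fun t ht => (hf t (interior_subset ht)).differentiableAt.differentiableWithinAt)
      (fun t ht => ?_)
    rw [(hf t (interior_subset ht)).deriv]
    exact hf' t (interior_subset ht)
  refine le_of_tendsto hl ?_
  filter_upwards [Ioc_mem_nhdsGT hT] with t ht
  exact hm ht (right_mem_Ioc.2 hT) ht.2

theorem integrable_thetaKernel_comp {x : 𝔼} {t : ℝ} (ht : 0 < t) :
    Integrable (fun z => thetaKernel N (t⁻¹ • (x - z))) := by
  have hc : Continuous fun z => thetaKernel N (t⁻¹ • (x - z)) := by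
    have := (contDiff_thetaKernel (N := N)).continuous
    fun_prop
  exact hc.integrable_of_hasCompactSupport (hasCompactSupport_kernel tsupport_thetaKernel ht x)

theorem integral_thetaKernel_pos : 0 < ∫ y, thetaKernel N y := by
  have hi : Integrable (thetaKernel N) := by
    simpa using integrable_thetaKernel_comp (N := N) (x := 0) one_pos |>.comp_neg
  refine (integral_pos_iff_support_of_nonneg thetaKernel_nonneg hi).2 ?_
  refine (measure_ball_pos volume (0 : 𝔼) one_pos).trans_le (measure_mono fun y hy => ?_)
  exact (thetaKernel_pos (mem_ball_zero_iff.1 hy)).ne'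

theorem MemP.exists_pos_near (h : MemP N 1 0 M Ω u) {z : 𝔼} (hz : z ∈ frontier Ω)
    {r : ℝ} (hr : 0 < r) (hzr : closedBall z r ⊆ ball 0 1) : ∃ x ∈ closedBall z r, 0 < u x := by
  by_contra! hneg
  have hzΩ : z ∉ Ω := fun hzΩ => hz.2 (by rwa [h.1.interior_eq])
  have hu0 : u z = 0 := (h.2.2.2.1 z ⟨hzr (mem_closedBall_self hr.le), hzΩ⟩).1
  have hd : ∀ t ∈ Ioc 0 r, HasDerivAt (fun t => kavg u (rhoKernel N) N t z)
      ((t ^ (N + 1))⁻¹ * (t ^ 2 * ∫ x in Ω, thetaKernel N (t⁻¹ • (z - x)))) t := fun t ht =>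
    h.hasDerivAt_kavg kernelPair_rho_theta ht.1 ((closedBall_subset_closedBall ht.2).trans hzr)
  have hpos : ∀ t ∈ Ioc 0 r,
      0 < (t ^ (N + 1))⁻¹ * (t ^ 2 * ∫ x in Ω, thetaKernel N (t⁻¹ • (z - x))) := by
    rintro t ⟨ht, -⟩
    have : 0 < ∫ x in Ω, thetaKernel N (t⁻¹ • (z - x)) := by
      refine (setIntegral_pos_iff_support_of_nonneg_ae
        (Eventually.of_forall fun _ => thetaKernel_nonneg _)
        (integrable_thetaKernel_comp ht).integrableOn).2 ?_
      obtain ⟨q, hq, hq'⟩ := mem_closure_iff_nhds.1 (frontier_subset_closure hz) _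
        (ball_mem_nhds z ht)
      refine ((isOpen_ball.inter h.1).measure_pos volume ⟨q, hq, hq'⟩).trans_le
        (measure_mono fun y hy => ⟨?_, hy.2⟩)
      refine (thetaKernel_pos ?_).ne'
      rw [norm_smul, norm_inv, Real.norm_of_nonneg ht.le, inv_mul_lt_iff₀ ht, mul_one,
        ← dist_eq_norm, dist_comm]
      exact hy.1
    positivity
  have hle : ∀ t ∈ Ioc 0 r, kavg u (rhoKernel N) N t z ≤ 0 := by
    rintro t ⟨ht, htr⟩
    rw [kavg]
    refine mul_nonpos_of_nonneg_of_nonpos (by positivity) (integral_nonpos fun y => ?_)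
    by_cases hy : y ∈ closedBall z t
    · exact mul_nonpos_of_nonpos_of_nonneg (hneg y (closedBall_subset_closedBall htr hy))
        (rhoKernel_nonneg _)
    · simp [kernel_eq_zero tsupport_rhoKernel ht hy]
  have hlim := tendsto_kavg h.2.1.continuous (contDiff_rhoKernel (N := N)).continuous
    tsupport_rhoKernel z
  rw [hu0, mul_zero] at hlim
  have h0 : ∀ t ∈ Ioc 0 r, kavg u (rhoKernel N) N t z = 0 := fun t ht =>
    le_antisymm (hle t ht) (le_of_tendsto_of_hasDerivAt_nonneg
      (f := fun t => kavg u (rhoKernel N) N t z) ht.1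
      (fun s hs => hd s ⟨hs.1, hs.2.trans ht.2⟩) (fun s hs => (hpos s ⟨hs.1, hs.2.trans ht.2⟩).le)
      hlim)
  have hr2 : r / 2 ∈ Ioc 0 r := ⟨by linarith, by linarith⟩
  have h1 : (fun t => kavg u (rhoKernel N) N t z) =ᶠ[𝓝 (r / 2)] fun _ => 0 := by
    filter_upwards [Ioo_mem_nhds (show 0 < r / 2 by linarith) (show r / 2 < r by linarith)]
      with t ht using h0 t ⟨ht.1, ht.2.le⟩
  have h2 := (hd _ hr2).unique ((hasDerivAt_const (r / 2) (0 : ℝ)).congr_of_eventuallyEq h1)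
  exact (hpos _ hr2).ne' h2

theorem MemP.kavg_eq_of_subset (h : MemP N 1 0 M Ω u) {p : 𝔼} {T : ℝ} (hT : 0 < T)
    (hpT : closedBall p T ⊆ ball 0 1) (hpΩ : closedBall p T ⊆ Ω) :
    kavg u (rhoKernel N) N T p =
      (∫ y, rhoKernel N y) * u p + T ^ 2 / 2 * ∫ y, thetaKernel N y := by
  have hlim := tendsto_kavg h.2.1.continuous (contDiff_rhoKernel (N := N)).continuous
    tsupport_rhoKernel p
  have hq : Tendsto (fun t : ℝ => t ^ 2 / 2 * ∫ y, thetaKernel N y) (𝓝[>] 0) (𝓝 0) := by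
    have : Continuous fun t : ℝ => t ^ 2 / 2 * ∫ y, thetaKernel N y := by fun_prop
    simpa using (this.tendsto 0).mono_left nhdsWithin_le_nhds
  have hd : ∀ t ∈ Ioc 0 T, HasDerivAt
      (fun t => kavg u (rhoKernel N) N t p - t ^ 2 / 2 * ∫ y, thetaKernel N y) 0 t := by
    rintro t ⟨ht, htT⟩
    have h1 := h.hasDerivAt_kavg kernelPair_rho_theta ht
      ((closedBall_subset_closedBall htT).trans hpT)
    have h2 : HasDerivAt (fun t : ℝ => t ^ 2 / 2 * ∫ y, thetaKernel N y)
        (t * ∫ y, thetaKernel N y) t := by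
      have := ((hasDerivAt_pow 2 t).div_const 2).mul_const (∫ y, thetaKernel N y)
      refine this.congr_deriv ?_
      simp
    refine (h1.sub h2).congr_deriv ?_
    rw [setIntegral_eq_integral_of_forall_compl_eq_zero, integral_comp_kernel _ ht]
    · field_simp
      ring
    · intro x hx
      exact kernel_eq_zero tsupport_thetaKernel ht
        fun hx' => hx (hpΩ (closedBall_subset_closedBall htT hx'))
  have key := le_of_tendsto_of_hasDerivAt_nonneg hT hd (fun _ _ => le_rfl) (hlim.sub hq)
  have key' := le_of_tendsto_of_hasDerivAt_nonneg hT (fun t ht => (hd t ht).neg)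
    (fun _ _ => by simp) (hlim.sub hq).neg
  simp only [Pi.neg_apply] at key'
  linarith

theorem MemP.exists_large_value_of_pos (h : MemP N 1 0 M Ω u) (hN : 0 < N) {q : 𝔼} {r : ℝ}
    (hr : 0 < r) (hqr : closedBall q r ⊆ ball 0 1) (hq : 0 < u q) :
    ∃ x ∈ closedBall q r,
      (∫ y, thetaKernel N y) / (4 * ∫ y, rhoKernel N y) * r ^ 2 ≤ u x := by
  have hθ := integral_thetaKernel_pos (N := N)
  have hρ := integral_rhoKernel_pos hN
  set A := ∫ y, thetaKernel N y
  set c := ∫ y, rhoKernel N y with hc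
  set a := A / (4 * c) with ha
  have ha0 : 0 < a := by positivity
  have hac : a * c = A / 4 := by rw [ha]; field_simp
  have hcu := h.2.1.continuous
  obtain ⟨p, hp, hmax⟩ := (isCompact_closedBall q r).exists_isMaxOn
    ⟨q, mem_closedBall_self hr.le⟩ (f := fun x => u x - a * ‖x - q‖ ^ 2) (by fun_prop)
  have hmax' : ∀ x ∈ closedBall q r, u x - a * ‖x - q‖ ^ 2 ≤ u p - a * ‖p - q‖ ^ 2 := hmax
  have hpq := hmax' q (mem_closedBall_self hr.le)
  simp only [sub_self, norm_zero, ne_eq, OfNat.ofNat_ne_zero, not_false_eq_true, zero_pow,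
    mul_zero, sub_zero] at hpq
  rcases (mem_closedBall.1 hp).lt_or_eq with hlt | heq
  · exfalso
    have hup : 0 < u p := by
      have : 0 ≤ a * ‖p - q‖ ^ 2 := by positivity
      linarith
    have hp1 := hqr hp
    have hpΩ : p ∈ Ω := by
      by_contra hpΩ
      exact hup.ne' (h.2.2.2.1 p ⟨hp1, hpΩ⟩).1
    obtain ⟨T, hT, hTs⟩ := nhds_basis_closedBall.mem_iff.1
      ((h.1.inter isOpen_ball).mem_nhds ⟨hpΩ, mem_ball.2 hlt⟩)
    have hTs' : closedBall p T ⊆ closedBall q r := fun x hx =>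
      ball_subset_closedBall (hTs hx).2
    have h1 := h.kavg_eq_of_subset hT (hTs'.trans hqr) fun x hx => (hTs hx).1
    have hρc := (contDiff_rhoKernel (N := N)).continuous
    have hρs : HasCompactSupport (rhoKernel N) := (isCompact_closedBall 0 1).of_isClosed_subset
      (isClosed_tsupport _) tsupport_rhoKernel
    have hinteg : ∀ {g : 𝔼 → ℝ}, Continuous g → Integrable fun y => g y * rhoKernel N y :=
      fun hg => (hg.mul hρc).integrable_of_hasCompactSupport hρs.mul_left
    have h2 : kavg u (rhoKernel N) N T p ≤ ∫ y, (u p - a * ‖p - q‖ ^ 2 +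
        a * (‖p - q‖ ^ 2 - 2 * T * ⟪p - q, y⟫ + T ^ 2)) * rhoKernel N y := by
      rw [kavg_eq_integral u _ hT]
      refine integral_mono (hinteg (by fun_prop)) (hinteg (by fun_prop)) fun y => ?_
      by_cases hy : y ∈ closedBall (0 : 𝔼) 1
      · refine mul_le_mul_of_nonneg_right ?_ (rhoKernel_nonneg y)
        rw [mem_closedBall_zero_iff] at hy
        have hx : p - T • y ∈ closedBall p T := by
          rw [mem_closedBall, dist_eq_norm, sub_sub_cancel_left, norm_neg, norm_smul,
            Real.norm_of_nonneg hT.le]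
          exact mul_le_of_le_one_right hT.le hy
        have h3 := hmax' _ (hTs' hx)
        have h4 : ‖p - T • y - q‖ ^ 2 ≤ ‖p - q‖ ^ 2 - 2 * T * ⟪p - q, y⟫ + T ^ 2 := by
          rw [sub_right_comm, norm_sub_sq_real, inner_smul_right, norm_smul,
            Real.norm_of_nonneg hT.le, mul_pow]
          have : T ^ 2 * ‖y‖ ^ 2 ≤ T ^ 2 :=
            mul_le_of_le_one_right (by positivity) (pow_le_one₀ (norm_nonneg y) hy)
          linarith
        have h5 := mul_le_mul_of_nonneg_left h4 ha0.le
        linarith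
      · have : rhoKernel N y = 0 := by
          by_contra hne
          exact hy (tsupport_rhoKernel (subset_tsupport _ hne))
        simp [this]
    have hodd : ∫ y, ⟪p - q, y⟫ * rhoKernel N y = 0 := by
      have e := integral_neg_eq_self (fun y : 𝔼 => ⟪p - q, y⟫ * rhoKernel N y) volume
      have e2 : ∀ y : 𝔼, ⟪p - q, -y⟫ * rhoKernel N (-y) = -(⟪p - q, y⟫ * rhoKernel N y) := by
        intro y
        simp [rhoKernel]
      simp only [e2, integral_neg] at e
      linarith
    have h3 : ∫ y, (u p - a * ‖p - q‖ ^ 2 +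
        a * (‖p - q‖ ^ 2 - 2 * T * ⟪p - q, y⟫ + T ^ 2)) * rhoKernel N y =
        (u p + a * T ^ 2) * c := by
      have e : ∀ y, (u p - a * ‖p - q‖ ^ 2 +
          a * (‖p - q‖ ^ 2 - 2 * T * ⟪p - q, y⟫ + T ^ 2)) * rhoKernel N y =
          (u p + a * T ^ 2) * rhoKernel N y + (-(2 * a * T)) * (⟪p - q, y⟫ * rhoKernel N y) := by
        intro y
        ring
      simp only [e]
      rw [integral_add ((hinteg continuous_const)) ((hinteg (by fun_prop)).const_mul _),
        integral_const_mul, integral_const_mul, hodd]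
      simp [hc]
    rw [h3] at h2
    have h4 : 0 < T ^ 2 * A := by positivity
    have h5 : (u p + a * T ^ 2) * c = c * u p + T ^ 2 * (a * c) := by ring
    rw [h5, hac] at h2
    linarith
  · refine ⟨p, hp, ?_⟩
    rw [dist_eq_norm] at heq
    rw [heq] at hpq
    linarith

theorem exists_large_value (hN : 0 < N) : ∃ a : ℝ, 0 < a ∧ ∀ (M : ℝ) (Ω : Set 𝔼) (u : 𝔼 → ℝ),
    MemP N 1 0 M Ω u → ∀ z ∈ frontier Ω, ∀ r > 0, closedBall z r ⊆ ball 0 1 →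
      ∃ x ∈ closedBall z r, a * r ^ 2 ≤ u x := by
  have hθ := integral_thetaKernel_pos (N := N)
  have hρ := integral_rhoKernel_pos hN
  refine ⟨(∫ y, thetaKernel N y) / (4 * ∫ y, rhoKernel N y) / 4, by positivity,
    fun M Ω u h z hz r hr hzr => ?_⟩
  obtain ⟨q, hq, hq0⟩ := h.exists_pos_near hz (half_pos hr)
    ((closedBall_subset_closedBall (by linarith)).trans hzr)
  have hsub : closedBall q (r / 2) ⊆ closedBall z r :=
    closedBall_subset_closedBall' (by rw [mem_closedBall] at hq; linarith)
  obtain ⟨x, hx, hx'⟩ := h.exists_large_value_of_pos hN (half_pos hr) (hsub.trans hzr) hq0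
  refine ⟨x, hsub hx, le_of_eq_of_le ?_ hx'⟩
  ring

theorem exists_interior_ball (hN : 0 < N) {M : ℝ} (hM : 0 < M) :
    ∃ c C : ℝ, 0 < c ∧ c ≤ 1 / 2 ∧ 0 < C ∧ ∀ (Ω : Set 𝔼) (u : 𝔼 → ℝ), MemP N 1 0 M Ω u →
      ∀ z ∈ frontier Ω, ‖z‖ ≤ 3 / 4 → ∀ ε, 0 < ε → ε ≤ 1 / 16 →
        (∃ y, ball y (c * ε) ⊆ Ω ∩ ball z ε) ∧
          ∀ x ∈ ball z ε, ∀ v, |dirDeriv v u x| ≤ C * ε * ‖v‖ := by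
  obtain ⟨C, hC, hgrad⟩ := exists_quadratic_growth (N := N) hN hM
  obtain ⟨a, ha, hval⟩ := exists_large_value (N := N) hN
  refine ⟨min (1 / 2) (a / (8 * C)), C, by positivity, min_le_left _ _, hC,
    fun Ω u h z hz hz' ε hε hε' => ?_⟩
  set c := min (1 / 2) (a / (8 * C)) with hc
  have hzΩ : z ∉ Ω := fun hzΩ => hz.2 (by rwa [h.1.interior_eq])
  have hzr : closedBall z ε ⊆ ball 0 1 := by
    refine (closedBall_subset_ball' (ε₂ := 1) ?_)
    rw [dist_zero_right]
    linarith
  have hbd : ∀ x ∈ ball z ε, ∀ v, |dirDeriv v u x| ≤ C * ε * ‖v‖ := by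
    intro x hx v
    rw [mem_ball] at hx
    refine (hgrad Ω u h z hzΩ hz' x (hx.le.trans hε') v).trans ?_
    gcongr
  refine ⟨?_, hbd⟩
  obtain ⟨y, hy, hy'⟩ := hval M Ω u h z hz (ε / 2) (by positivity)
    ((closedBall_subset_closedBall (by linarith)).trans hzr)
  have hsub : ball y (c * ε) ⊆ ball z ε := by
    refine ball_subset_ball' ?_
    rw [mem_closedBall] at hy
    have : c * ε ≤ 1 / 2 * ε := mul_le_mul_of_nonneg_right (min_le_left _ _) hε.le
    linarith
  refine ⟨y, fun x hx => ⟨?_, hsub hx⟩⟩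
  by_contra hxΩ
  have hux : u x = 0 := (h.2.2.2.1 x ⟨hzr (ball_subset_closedBall (hsub hx)), hxΩ⟩).1
  have hyz : y ∈ ball z ε := by
    rw [mem_closedBall] at hy
    rw [mem_ball]
    linarith
  have hmv := (convex_ball z ε).norm_image_sub_le_of_norm_fderiv_le (𝕜 := ℝ) (f := u)
    (C := C * ε) (fun w _ => h.2.1.differentiable (by simp) w)
    (fun w hw => ContinuousLinearMap.opNorm_le_bound _ (by positivity) fun v => hbd w hw v)
    (hsub hx) hyz
  rw [hux, sub_zero] at hmv
  rw [mem_ball, dist_comm, dist_eq_norm] at hx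
  have h1 : c * ε ≤ a / (8 * C) * ε := mul_le_mul_of_nonneg_right (min_le_right _ _) hε.le
  have h2 : C * ε * ‖y - x‖ ≤ C * ε * (a / (8 * C) * ε) :=
    mul_le_mul_of_nonneg_left (hx.le.trans h1) (by positivity)
  have h3 : C * ε * (a / (8 * C) * ε) = a * ε ^ 2 / 8 := by field_simp
  have h4 := le_abs_self (u y)
  rw [Real.norm_eq_abs] at hmv
  have h5 : 0 < a * ε ^ 2 := by positivity
  have h6 : a * (ε / 2) ^ 2 = a * ε ^ 2 / 4 := by ring
  linarith

end Nondegeneracy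

section LocalSmoothness

variable {N : ℕ}

local notation "𝔼" => EuclideanSpace ℝ (Fin N)

variable {M : ℝ} {Ω : Set (EuclideanSpace ℝ (Fin N))} {u : EuclideanSpace ℝ (Fin N) → ℝ}

theorem dirDeriv_congr {f g : 𝔼 → ℝ} {x : 𝔼} (h : f =ᶠ[𝓝 x] g) (v : 𝔼) :
    dirDeriv v f =ᶠ[𝓝 x] dirDeriv v g := by
  filter_upwards [h.fderiv (𝕜 := ℝ)] with y hy
  rw [dirDeriv, hy, dirDeriv]

theorem lap_congr {f g : 𝔼 → ℝ} {x : 𝔼} (h : f =ᶠ[𝓝 x] g) : lap N f x = lap N g x := by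
  simp only [lap_eq_sum]
  exact Finset.sum_congr rfl fun i _ => (dirDeriv_congr (dirDeriv_congr h _) _).eq_of_nhds

theorem contDiffAt_dirDeriv {f : 𝔼 → ℝ} {x : 𝔼} (h : ContDiffAt ℝ ∞ f x) (v : 𝔼) :
    ContDiffAt ℝ ∞ (dirDeriv v f) x :=
  (h.fderiv_right (m := ∞) (by simp)).clm_apply contDiffAt_const

theorem contDiffAt_lap {f : 𝔼 → ℝ} {x : 𝔼} (h : ContDiffAt ℝ ∞ f x) :
    ContDiffAt ℝ ∞ (lap N f) x :=
  ContDiffAt.sum fun _ _ => contDiffAt_dirDeriv (contDiffAt_dirDeriv h _) _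

theorem continuous_mul_of_contDiffAt {f η : 𝔼 → ℝ} (hη : Continuous η)
    (hf : ∀ x ∈ tsupport η, ContDiffAt ℝ ∞ f x) : Continuous fun x => η x * f x :=
  continuous_of_tsupport fun x hx =>
    hη.continuousAt.mul (hf x (tsupport_mul_subset_left hx)).continuousAt

theorem integral_mul_dirDeriv {f η : 𝔼 → ℝ} (hη : ContDiff ℝ ∞ η) (hc : HasCompactSupport η)
    (hf : ∀ x ∈ tsupport η, ContDiffAt ℝ ∞ f x) (v : 𝔼) :
    ∫ x, η x * dirDeriv v f x = -∫ x, dirDeriv v η x * f x := by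
  have hcd : HasCompactSupport (dirDeriv v η) :=
    hc.of_isClosed_subset (isClosed_tsupport _) (tsupport_dirDeriv_subset η v)
  refine integral_mul_fderiv_eq_neg_fderiv_mul_of_integrable ?_ ?_ ?_
    (fun x _ => hη.differentiable (by simp) x) (fun x hx => (hf x ?_).differentiableAt (by simp))
  · exact (continuous_mul_of_contDiffAt (contDiff_dirDeriv hη v).continuous fun x hx =>
      hf x (tsupport_dirDeriv_subset η v hx)).integrable_of_hasCompactSupport hcd.mul_right
  · exact (continuous_mul_of_contDiffAt hη.continuous fun x hx =>
      contDiffAt_dirDeriv (hf x hx) v).integrable_of_hasCompactSupport hc.mul_right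
  · exact (continuous_mul_of_contDiffAt hη.continuous hf).integrable_of_hasCompactSupport
      hc.mul_right
  · exact hx

theorem integral_mul_lap {f η : 𝔼 → ℝ} (hη : ContDiff ℝ ∞ η) (hc : HasCompactSupport η)
    (hf : ∀ x ∈ tsupport η, ContDiffAt ℝ ∞ f x) :
    ∫ x, η x * lap N f x = ∫ x, lap N η x * f x := by
  have hcd : ∀ v : 𝔼, HasCompactSupport (dirDeriv v η) := fun v =>
    hc.of_isClosed_subset (isClosed_tsupport _) (tsupport_dirDeriv_subset η v)
  have hcd2 : ∀ v : 𝔼, HasCompactSupport (dirDeriv v (dirDeriv v η)) := fun v =>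
    (hcd v).of_isClosed_subset (isClosed_tsupport _) (tsupport_dirDeriv_subset _ v)
  simp only [lap_eq_sum, Finset.mul_sum, Finset.sum_mul]
  rw [integral_finsetSum, integral_finsetSum]
  · refine Finset.sum_congr rfl fun i _ => ?_
    rw [integral_mul_dirDeriv hη hc fun x hx => contDiffAt_dirDeriv (hf x hx) _,
      integral_mul_dirDeriv (contDiff_dirDeriv hη _) (hcd _) fun x hx =>
        hf x (tsupport_dirDeriv_subset η _ hx), neg_neg]
  · intro i _
    exact (continuous_mul_of_contDiffAt (contDiff_dirDeriv (contDiff_dirDeriv hη _) _).continuous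
      fun x hx => hf x (tsupport_dirDeriv_subset η _ (tsupport_dirDeriv_subset _ _ hx))
      ).integrable_of_hasCompactSupport (hcd2 _).mul_right
  · intro i _
    exact (continuous_mul_of_contDiffAt hη.continuous fun x hx =>
      contDiffAt_dirDeriv (contDiffAt_dirDeriv (hf x hx) _) _).integrable_of_hasCompactSupport
      hc.mul_right

theorem dirDeriv_comp {Ψ Ψ' : ℝ → ℝ} (hΨ : ∀ t, HasDerivAt Ψ (Ψ' t) t) {w : 𝔼 → ℝ} {x : 𝔼}
    (hw : DifferentiableAt ℝ w x) (v : 𝔼) :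
    dirDeriv v (fun y => Ψ (w y)) x = Ψ' (w x) * dirDeriv v w x := by
  have h := (hΨ (w x)).comp_hasFDerivAt x hw.hasFDerivAt
  rw [dirDeriv, show (fun y => Ψ (w y)) = Ψ ∘ w from rfl, h.fderiv]
  rfl

theorem dirDeriv_mul {f g : 𝔼 → ℝ} {x : 𝔼} (hf : DifferentiableAt ℝ f x)
    (hg : DifferentiableAt ℝ g x) (v : 𝔼) :
    dirDeriv v (fun y => f y * g y) x = dirDeriv v f x * g x + f x * dirDeriv v g x := by
  have e : fderiv ℝ (fun y => f y * g y) x = f x • fderiv ℝ g x + g x • fderiv ℝ f x :=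
    fderiv_mul hf hg
  simp only [dirDeriv, e, _root_.add_apply, _root_.smul_apply, smul_eq_mul]
  ring

theorem lap_comp {Ψ Ψ' Ψ'' : ℝ → ℝ} (hΨ : ∀ t, HasDerivAt Ψ (Ψ' t) t)
    (hΨ' : ∀ t, HasDerivAt Ψ' (Ψ'' t) t) {w : 𝔼 → ℝ} {x : 𝔼} (hw : ContDiffAt ℝ ∞ w x) :
    lap N (fun y => Ψ (w y)) x = Ψ'' (w x) *
      ∑ i, dirDeriv (EuclideanSpace.single i 1) w x ^ 2 + Ψ' (w x) * lap N w x := by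
  have hdw : ∀ᶠ y in 𝓝 x, DifferentiableAt ℝ w y := by
    filter_upwards [(hw.of_le (m := 1) (by simp)).eventually (by simp)] with y hy
    exact hy.differentiableAt (by simp)
  simp only [lap_eq_sum, Finset.mul_sum, ← Finset.sum_add_distrib]
  refine Finset.sum_congr rfl fun i _ => ?_
  have e : dirDeriv (EuclideanSpace.single i 1) (fun y => Ψ (w y)) =ᶠ[𝓝 x]
      fun y => Ψ' (w y) * dirDeriv (EuclideanSpace.single i 1) w y := by
    filter_upwards [hdw] with y hy using dirDeriv_comp hΨ hy _
  rw [(dirDeriv_congr e _).eq_of_nhds, dirDeriv_mul _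
    ((contDiffAt_dirDeriv hw _).differentiableAt (by simp)), dirDeriv_comp hΨ' hdw.self_of_nhds]
  · ring
  · exact (hΨ' (w x)).differentiableAt.comp x hdw.self_of_nhds

theorem MemP.exists_smooth_eventuallyEq (h : MemP N 1 0 M Ω u) (hN : 0 < N) {p : 𝔼}
    (hp : p ∈ Ω) (hp1 : p ∈ ball (0 : 𝔼) 1) :
    ∃ g : 𝔼 → ℝ, ContDiff ℝ ∞ g ∧ u =ᶠ[𝓝 p] g ∧ ∀ᶠ x in 𝓝 p, lap N g x = 1 := by
  have hc0 := integral_rhoKernel_pos hN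
  set c := ∫ y, rhoKernel N y with hc
  obtain ⟨T, hT, hTs⟩ := nhds_basis_closedBall.mem_iff.1
    ((h.1.inter isOpen_ball).mem_nhds ⟨hp, hp1⟩)
  have hT2 : 0 < T / 2 := by positivity
  have hsub : ∀ x ∈ ball p (T / 2), closedBall x (T / 2) ⊆ Ω ∩ ball 0 1 := fun x hx =>
    (closedBall_subset_closedBall' (by rw [mem_ball] at hx; linarith)).trans hTs
  have hk : ContDiff ℝ ∞ (kavg u (rhoKernel N) N (T / 2)) :=
    contDiff_kavg h.2.1.continuous contDiff_rhoKernel tsupport_rhoKernel N hT2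
  refine ⟨fun x => c⁻¹ * kavg u (rhoKernel N) N (T / 2) x -
    c⁻¹ * ((T / 2) ^ 2 / 2 * ∫ y, thetaKernel N y), by fun_prop, ?_, ?_⟩
  · filter_upwards [ball_mem_nhds p hT2] with x hx
    rw [h.kavg_eq_of_subset hT2 (fun y hy => (hsub x hx hy).2) fun y hy => (hsub x hx hy).1,
      mul_add, inv_mul_cancel_left₀ hc0.ne']
    ring
  · filter_upwards [ball_mem_nhds p hT2] with x hx
    have e1 : ∀ (k : 𝔼 → ℝ) (_ : ContDiff ℝ ∞ k) (b : ℝ) (v : 𝔼),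
        dirDeriv v (fun x => c⁻¹ * k x - b) = fun x => c⁻¹ * dirDeriv v k x - 0 := by
      intro k hk b v
      funext y
      have hd := ((hk.differentiable (by simp) y).hasFDerivAt.const_mul c⁻¹).sub_const b
      rw [dirDeriv, hd.fderiv]
      simp [dirDeriv]
    have e2 := h.trace_kHess_eq hT2 fun y hy => (hsub x hx hy).2
    rw [setIntegral_eq_integral_of_forall_compl_eq_zero fun y hy =>
      kernel_eq_zero tsupport_rhoKernel hT2 fun hy' => hy (hsub x hx hy').1,
      integral_comp_kernel _ hT2, inv_mul_cancel_left₀ (by positivity), ← hc] at e2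
    rw [lap_eq_sum]
    simp only [e1 _ hk, fun v => e1 _ (contDiff_dirDeriv hk v) 0 v]
    simp only [sub_zero]
    rw [← Finset.mul_sum]
    have e3 : ∀ v, dirDeriv v (dirDeriv v (kavg u (rhoKernel N) N (T / 2))) x =
        kHess u (T / 2) x v v := by
      intro v
      rw [dirDeriv_kavg h.2.1.continuous contDiff_rhoKernel tsupport_rhoKernel N hT2,
        dirDeriv_kavg h.2.1.continuous (contDiff_dirDeriv contDiff_rhoKernel v)
          ((tsupport_dirDeriv_subset _ v).trans tsupport_rhoKernel) (N + 1) hT2]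
      rfl
    simp only [e3]
    rw [e2, inv_mul_cancel₀ hc0.ne']

theorem MemP.contDiffAt (h : MemP N 1 0 M Ω u) (hN : 0 < N) {p : 𝔼}
    (hp : p ∈ Ω) (hp1 : p ∈ ball (0 : 𝔼) 1) : ContDiffAt ℝ ∞ u p := by
  obtain ⟨g, hg, hug, -⟩ := h.exists_smooth_eventuallyEq hN hp hp1
  exact hg.contDiffAt.congr_of_eventuallyEq hug

theorem MemP.lap_eq_one (h : MemP N 1 0 M Ω u) (hN : 0 < N) {p : 𝔼}
    (hp : p ∈ Ω) (hp1 : p ∈ ball (0 : 𝔼) 1) : lap N u p = 1 := by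
  obtain ⟨g, -, hug, hl⟩ := h.exists_smooth_eventuallyEq hN hp hp1
  rw [lap_congr hug, hl.self_of_nhds]

theorem MemP.lap_dirDeriv_eq_zero (h : MemP N 1 0 M Ω u) (hN : 0 < N) {p : 𝔼}
    (hp : p ∈ Ω) (hp1 : p ∈ ball (0 : 𝔼) 1) (v : 𝔼) : lap N (dirDeriv v u) p = 0 := by
  obtain ⟨g, hg, hug, hl⟩ := h.exists_smooth_eventuallyEq hN hp hp1
  have e : lap N g =ᶠ[𝓝 p] fun _ => 1 := hl
  rw [lap_congr (dirDeriv_congr hug v), lap_dirDeriv hg, (dirDeriv_congr e v).eq_of_nhds, dirDeriv,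
    fderiv_fun_const]
  rfl

end LocalSmoothness

section ConvexCutoff

theorem exists_convex_cutoff {ε s : ℝ} (hε : 0 < ε) (hs : 0 < s) :
    ∃ Ψ Ψ' Ψ'' : ℝ → ℝ, ContDiff ℝ ∞ Ψ ∧ (∀ t, HasDerivAt Ψ (Ψ' t) t) ∧
      (∀ t, HasDerivAt Ψ' (Ψ'' t) t) ∧ (∀ t, 0 ≤ Ψ'' t) ∧ (∀ t, |t| ≤ s → Ψ t = 0) ∧
      (∀ t, 2 * s ≤ |t| → |t| ≤ ε → Ψ'' t = 1) ∧ ∀ t, |Ψ t| ≤ 4 * ε * |t| := by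
  set k : ℝ → ℝ := fun t => Real.smoothTransition ((t ^ 2 - s ^ 2) / (3 * s ^ 2)) *
    Real.smoothTransition ((4 * ε ^ 2 - t ^ 2) / (3 * ε ^ 2)) with hk
  have hkc : ContDiff ℝ ∞ k :=
    (Real.smoothTransition.contDiff.comp (by fun_prop)).mul
      (Real.smoothTransition.contDiff.comp (by fun_prop))
  have hk0 : ∀ t, 0 ≤ k t := fun t =>
    mul_nonneg (Real.smoothTransition.nonneg _) (Real.smoothTransition.nonneg _)
  have hk1 : ∀ t, k t ≤ 1 := fun t => mul_le_one₀ (Real.smoothTransition.le_one _)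
    (Real.smoothTransition.nonneg _) (Real.smoothTransition.le_one _)
  have hks : ∀ t, |t| ≤ s → k t = 0 := by
    intro t ht
    have : t ^ 2 ≤ s ^ 2 := sq_le_sq' (abs_le.1 ht).1 (abs_le.1 ht).2
    simp only [hk]
    rw [Real.smoothTransition.zero_of_nonpos, zero_mul]
    exact div_nonpos_of_nonpos_of_nonneg (by linarith) (by positivity)
  have hkl : ∀ t, 2 * ε < |t| → k t = 0 := by
    intro t ht
    have : (2 * ε) ^ 2 ≤ |t| ^ 2 := pow_le_pow_left₀ (by positivity) ht.le 2
    rw [sq_abs] at this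
    simp only [hk]
    rw [Real.smoothTransition.zero_of_nonpos (x := _ / (3 * ε ^ 2)), mul_zero]
    exact div_nonpos_of_nonpos_of_nonneg (by linarith) (by positivity)
  set Φ : ℝ → ℝ := fun t => ∫ x in (0 : ℝ)..t, k x with hΦ
  have hΦd : ∀ t, HasDerivAt Φ (k t) t := fun t => hkc.continuous.integral_hasStrictDerivAt 0 t
    |>.hasDerivAt
  have hΦc : ContDiff ℝ ∞ Φ := by
    refine contDiff_infty_iff_deriv.2 ⟨fun t => (hΦd t).differentiableAt, ?_⟩
    rwa [show deriv Φ = k from funext fun t => (hΦd t).deriv]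
  have hΨd : ∀ t, HasDerivAt (fun t => ∫ x in (0 : ℝ)..t, Φ x) (Φ t) t := fun t =>
    hΦc.continuous.integral_hasStrictDerivAt 0 t |>.hasDerivAt
  have hsub : ∀ {s t x : ℝ}, |t| ≤ s → x ∈ uIcc 0 t → |x| ≤ s := by
    intro s t x ht hx
    rw [abs_le] at ht ⊢
    have h0 : 0 ≤ s := by linarith [ht.1, ht.2]
    exact uIcc_subset_Icc (by constructor <;> linarith) ht hx
  have hΦs : ∀ t, |t| ≤ s → Φ t = 0 := by
    intro t ht
    simp only [hΦ]
    rw [intervalIntegral.integral_congr (g := fun _ => 0) fun x hx => hks x (hsub ht hx)]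
    simp
  have hΦb : ∀ t, ‖Φ t‖ ≤ 4 * ε := by
    intro t
    have hi : IntegrableOn (fun _ : ℝ => (1 : ℝ)) (Icc (-(2 * ε)) (2 * ε)) := by simp
    calc ‖Φ t‖ ≤ ∫ x in uIoc 0 t, ‖k x‖ := intervalIntegral.norm_integral_le_integral_norm_uIoc
      _ ≤ ∫ x in uIoc 0 t, (Icc (-(2 * ε)) (2 * ε)).indicator (fun _ => (1 : ℝ)) x := by
        refine setIntegral_mono ((hkc.continuous.norm.integrableOn_uIoc))
          (hi.integrable_indicator measurableSet_Icc).integrableOn fun x => ?_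
        by_cases hx : x ∈ Icc (-(2 * ε)) (2 * ε)
        · simp only [indicator_of_mem hx, Real.norm_of_nonneg (hk0 x)]
          exact hk1 x
        · simp only [indicator_of_notMem hx]
          rw [hkl x, norm_zero]
          by_contra hle
          exact hx (abs_le.1 (not_lt.1 hle))
      _ ≤ ∫ x, (Icc (-(2 * ε)) (2 * ε)).indicator (fun _ => (1 : ℝ)) x :=
        setIntegral_le_integral (hi.integrable_indicator measurableSet_Icc)
          (Eventually.of_forall fun x => indicator_nonneg (fun _ _ => zero_le_one) x)
      _ = 4 * ε := by
        rw [integral_indicator measurableSet_Icc]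
        simp [Real.volume_real_Icc_of_le (show -(2 * ε) ≤ 2 * ε by linarith)]
        ring
  refine ⟨fun t => ∫ x in (0 : ℝ)..t, Φ x, Φ, k, ?_, hΨd, hΦd, hk0, ?_, ?_, ?_⟩
  · refine contDiff_infty_iff_deriv.2 ⟨fun t => (hΨd t).differentiableAt, ?_⟩
    rwa [show deriv (fun t => ∫ x in (0 : ℝ)..t, Φ x) = Φ from funext fun t => (hΨd t).deriv]
  · intro t ht
    dsimp only
    rw [intervalIntegral.integral_congr (g := fun _ => 0) fun x hx => hΦs x (hsub ht hx)]
    simp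
  · intro t h1 h2
    have h3 : (2 * s) ^ 2 ≤ |t| ^ 2 := pow_le_pow_left₀ (by positivity) h1 2
    have h4 : |t| ^ 2 ≤ ε ^ 2 := pow_le_pow_left₀ (abs_nonneg t) h2 2
    rw [sq_abs] at h3 h4
    simp only [hk]
    rw [Real.smoothTransition.one_of_one_le, Real.smoothTransition.one_of_one_le, mul_one]
    · rw [le_div_iff₀ (by positivity)]
      linarith
    · rw [le_div_iff₀ (by positivity)]
      linarith
  · intro t
    have := intervalIntegral.norm_integral_le_of_norm_le_const (a := 0) (b := t) (f := Φ)
      (C := 4 * ε) fun x _ => hΦb x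
    simpa using this

end ConvexCutoff

section SmallGradient

variable {N : ℕ}

local notation "𝔼" => EuclideanSpace ℝ (Fin N)

variable {M : ℝ} {Ω : Set (EuclideanSpace ℝ (Fin N))} {u : EuclideanSpace ℝ (Fin N) → ℝ}

theorem ae_dirDeriv_eq_zero_of_eq_zero {w : 𝔼 → ℝ} (hw : Continuous w) (v : 𝔼) :
    ∀ᵐ x, w x = 0 → dirDeriv v w x = 0 := by
  have hd : Measurable (dirDeriv v w) := measurable_fderiv_apply_const ℝ w v
  have hm : MeasurableSet {x | w x = 0 → dirDeriv v w x = 0} := by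
    have e : {x | w x = 0 → dirDeriv v w x = 0} = (w ⁻¹' {0})ᶜ ∪ dirDeriv v w ⁻¹' {0} := by
      ext x
      simp [imp_iff_not_or]
    rw [e]
    exact (hw.measurable (measurableSet_singleton 0)).compl.union (hd (measurableSet_singleton 0))
  refine ae_mem_of_ae_add_linearMap_mem (μ := (volume : Measure ℝ)) (ν := (volume : Measure 𝔼))
    (LinearMap.toSpanSingleton ℝ 𝔼 v) hm fun y => ?_
  have hc : {t : ℝ | w (y + t • v) = 0 ∧ dirDeriv v w (y + t • v) ≠ 0}.Countable := by
    refine Countable.mono (fun t ht => ?_) (countable_setOfPred_isolated_right_within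
      (s := {t : ℝ | w (y + t • v) = 0 ∧ dirDeriv v w (y + t • v) ≠ 0}))
    refine ⟨ht, ?_⟩
    have hdiff : DifferentiableAt ℝ w (y + t • v) := by
      by_contra hnd
      exact ht.2 (by rw [dirDeriv, fderiv_zero_of_not_differentiableAt hnd]; rfl)
    have h2 : HasDerivAt (fun s : ℝ => y + s • v) v t := by
      simpa using ((hasDerivAt_id t).smul_const v).const_add y
    have h3 := hdiff.hasFDerivAt.comp_hasDerivAt t h2
    have h4 := h3.eventually_ne (c := 0) ht.2
    rw [← Filter.empty_mem_iff_bot]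
    rw [eventually_nhdsWithin_iff] at h4
    filter_upwards [mem_nhdsWithin_of_mem_nhds h4, self_mem_nhdsWithin] with s hs hs'
    exact hs hs'.2.ne' hs'.1.1
  rw [ae_iff]
  refine measure_mono_null (fun t ht => ?_) (hc.measure_zero volume)
  exact Classical.not_imp.1 ht

theorem MemP.contDiffAt_comp_dirDeriv (h : MemP N 1 0 M Ω u) (hN : 0 < N) {Ψ : ℝ → ℝ}
    (hΨ : ContDiff ℝ ∞ Ψ) {s : ℝ} (hs : 0 < s) (hΨs : ∀ t, |t| ≤ s → Ψ t = 0)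
    (v : 𝔼) {x : 𝔼} (hx : x ∈ ball (0 : 𝔼) 1) :
    ContDiffAt ℝ ∞ (fun y => Ψ (dirDeriv v u y)) x := by
  have hcont : Continuous (dirDeriv v u) :=
    (h.2.1.continuous_fderiv (by simp)).clm_apply continuous_const
  by_cases hxΩ : x ∈ Ω
  · exact hΨ.contDiffAt.comp x (contDiffAt_dirDeriv (h.contDiffAt hN hxΩ hx) v)
  · have h0 : dirDeriv v u x = 0 := h.dirDeriv_eq_zero hx hxΩ v
    refine (contDiffAt_const (c := (0 : ℝ))).congr_of_eventuallyEq ?_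
    have : ∀ᶠ y in 𝓝 x, |dirDeriv v u y| < s :=
      (hcont.abs.tendsto x).eventually (gt_mem_nhds (by rw [h0, abs_zero]; exact hs))
    filter_upwards [this] with y hy using hΨs _ hy.le

theorem MemP.setLIntegral_energy_le (h : MemP N 1 0 M Ω u) (hN : 0 < N) {η : 𝔼 → ℝ}
    (hη : ContDiff ℝ ∞ η) (hη0 : ∀ x, 0 ≤ η x) {R : ℝ} (hηR : tsupport η ⊆ closedBall 0 R)
    (hR : R < 1) {A : Set 𝔼} (hA : MeasurableSet A) (hηA : ∀ x ∈ A, η x = 1) {v : 𝔼} {C₀ : ℝ}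
    (hC₀ : ∀ x ∈ closedBall (0 : 𝔼) R, |dirDeriv v u x| ≤ C₀) {ε s : ℝ} (hε : 0 < ε)
    (hs : 0 < s) :
    ∫⁻ x in A ∩ {x | 2 * s ≤ |dirDeriv v u x| ∧ |dirDeriv v u x| ≤ ε},
      ENNReal.ofReal (∑ i, dirDeriv (EuclideanSpace.single i 1) (dirDeriv v u) x ^ 2) ≤
        ENNReal.ofReal ((4 * C₀ * ∫ x, |lap N η x|) * ε) := by
  obtain ⟨Ψ, Ψ', Ψ'', hΨ, hd, hd', h0, hs0, h1, hb⟩ := exists_convex_cutoff hε hs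
  have hsub : tsupport η ⊆ ball 0 1 := hηR.trans (closedBall_subset_ball hR)
  have hc : HasCompactSupport η :=
    (isCompact_closedBall 0 R).of_isClosed_subset (isClosed_tsupport _) hηR
  have hcont : Continuous (dirDeriv v u) :=
    (h.2.1.continuous_fderiv (by simp)).clm_apply continuous_const
  set F : 𝔼 → ℝ := fun y => Ψ (dirDeriv v u y) with hF
  have hFs : ∀ x ∈ tsupport η, ContDiffAt ℝ ∞ F x := fun x hx =>
    h.contDiffAt_comp_dirDeriv hN hΨ hs hs0 v (hsub hx)
  have hlap : ∀ x ∈ Ω ∩ ball 0 1, lap N F x = Ψ'' (dirDeriv v u x) *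
      ∑ i, dirDeriv (EuclideanSpace.single i 1) (dirDeriv v u) x ^ 2 := by
    intro x hx
    rw [lap_comp hd hd' (contDiffAt_dirDeriv (h.contDiffAt hN hx.1 hx.2) v),
      h.lap_dirDeriv_eq_zero hN hx.1 hx.2, mul_zero, add_zero]
  have hlap0 : ∀ x ∈ ball (0 : 𝔼) 1, x ∉ Ω → lap N F x = 0 := by
    intro x hx hxΩ
    have h0 : dirDeriv v u x = 0 := h.dirDeriv_eq_zero hx hxΩ v
    have : F =ᶠ[𝓝 x] fun _ => 0 := by
      have : ∀ᶠ y in 𝓝 x, |dirDeriv v u y| < s :=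
        (hcont.abs.tendsto x).eventually (gt_mem_nhds (by rw [h0, abs_zero]; exact hs))
      filter_upwards [this] with y hy using hs0 _ hy.le
    rw [lap_congr this]
    simp [lap]
  have hnn : ∀ x, 0 ≤ η x * lap N F x := by
    intro x
    by_cases hx : x ∈ ball (0 : 𝔼) 1
    · by_cases hxΩ : x ∈ Ω
      · rw [hlap x ⟨hxΩ, hx⟩]
        exact mul_nonneg (hη0 x) (mul_nonneg (h0 _) (Finset.sum_nonneg fun _ _ => sq_nonneg _))
      · rw [hlap0 x hx hxΩ, mul_zero]
    · rw [image_eq_zero_of_notMem_tsupport fun hx' => hx (hsub hx'), zero_mul]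
  have hi1 : Integrable fun x => η x * lap N F x :=
    (continuous_mul_of_contDiffAt hη.continuous fun x hx =>
      contDiffAt_lap (hFs x hx)).integrable_of_hasCompactSupport hc.mul_right
  have hmeas : MeasurableSet {x | 2 * s ≤ |dirDeriv v u x| ∧ |dirDeriv v u x| ≤ ε} :=
    ((isClosed_le continuous_const hcont.abs).inter
      (isClosed_le hcont.abs continuous_const)).measurableSet
  have hlc := (contDiff_lap hη).continuous
  have hlz : ∀ x ∉ tsupport η, lap N η x = 0 := by
    intro x hx
    rw [lap_congr (notMem_tsupport_iff_eventuallyEq.1 hx)]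
    simp [lap, Pi.zero_def]
  have hls : HasCompactSupport (lap N η) := HasCompactSupport.intro hc hlz
  calc _ ≤ ∫⁻ x, ENNReal.ofReal (η x * lap N F x) := by
        rw [← lintegral_indicator (hA.inter hmeas)]
        refine lintegral_mono fun x => ?_
        by_cases hx : x ∈ A ∩ {x | 2 * s ≤ |dirDeriv v u x| ∧ |dirDeriv v u x| ≤ ε}
        · rw [indicator_of_mem hx]
          have hx1 : x ∈ ball (0 : 𝔼) 1 := by
            refine hsub (subset_tsupport η ?_)
            simp [hηA x hx.1]
          have hxΩ : x ∈ Ω := by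
            by_contra hxΩ
            have := hx.2.1
            rw [h.dirDeriv_eq_zero hx1 hxΩ v, abs_zero] at this
            linarith
          rw [hlap x ⟨hxΩ, hx1⟩, hηA x hx.1, h1 _ hx.2.1 hx.2.2, one_mul, one_mul]
        · rw [indicator_of_notMem hx]
          exact zero_le
    _ = ENNReal.ofReal (∫ x, η x * lap N F x) :=
        (ofReal_integral_eq_lintegral_ofReal hi1 (Eventually.of_forall hnn)).symm
    _ ≤ _ := by
        refine ENNReal.ofReal_le_ofReal ?_
        rw [integral_mul_lap hη hc hFs]
        have e : (4 * C₀ * ∫ x, |lap N η x|) * ε = ∫ x, |lap N η x| * (4 * ε * C₀) := by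
          rw [integral_mul_const]
          ring
        rw [e]
        have hcF : Continuous F := hΨ.continuous.comp hcont
        refine integral_mono ((hlc.mul hcF).integrable_of_hasCompactSupport hls.mul_right)
          ((hlc.abs.mul continuous_const).integrable_of_hasCompactSupport
            hls.abs.mul_right) fun x => ?_
        by_cases hx : x ∈ tsupport η
        · refine (le_abs_self _).trans ?_
          rw [abs_mul]
          refine mul_le_mul_of_nonneg_left ((hb _).trans ?_) (abs_nonneg _)
          exact mul_le_mul_of_nonneg_left (hC₀ x (hηR hx)) (by positivity)
        · simp [hlz x hx]

theorem MemP.inv_le_sum_hess_sq (h : MemP N 1 0 M Ω u) (hN : 0 < N) {x : 𝔼}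
    (hx : x ∈ Ω) (hx1 : x ∈ ball (0 : 𝔼) 1) :
    (N : ℝ)⁻¹ ≤ ∑ j : Fin N, ∑ i, dirDeriv (EuclideanSpace.single i 1)
      (dirDeriv (EuclideanSpace.single j 1) u) x ^ 2 := by
  have h1 := h.lap_eq_one hN hx hx1
  rw [lap_eq_sum] at h1
  have h2 := sq_sum_le_card_mul_sum_sq (s := Finset.univ) (f := fun i : Fin N =>
    dirDeriv (EuclideanSpace.single i 1) (dirDeriv (EuclideanSpace.single i 1) u) x)
  rw [h1, Finset.card_univ, Fintype.card_fin, one_pow] at h2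
  have hN' : (0 : ℝ) < N := by exact_mod_cast hN
  rw [inv_le_iff_one_le_mul₀' hN']
  refine h2.trans (mul_le_mul_of_nonneg_left (Finset.sum_le_sum fun j _ => ?_) hN'.le)
  exact Finset.single_le_sum (f := fun i => dirDeriv (EuclideanSpace.single i 1)
    (dirDeriv (EuclideanSpace.single j 1) u) x ^ 2) (fun _ _ => sq_nonneg _) (Finset.mem_univ j)

theorem MemP.setLIntegral_energy_le_of_abs_le (h : MemP N 1 0 M Ω u) (hN : 0 < N) {η : 𝔼 → ℝ}
    (hη : ContDiff ℝ ∞ η) (hη0 : ∀ x, 0 ≤ η x) {R : ℝ} (hηR : tsupport η ⊆ closedBall 0 R)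
    (hR : R < 1) {A : Set 𝔼} (hA : MeasurableSet A) (hηA : ∀ x ∈ A, η x = 1) {v : 𝔼} {C₀ : ℝ}
    (hC₀ : ∀ x ∈ closedBall (0 : 𝔼) R, |dirDeriv v u x| ≤ C₀) {ε : ℝ} (hε : 0 < ε) :
    ∫⁻ x in A ∩ {x | |dirDeriv v u x| ≤ ε},
      ENNReal.ofReal (∑ i, dirDeriv (EuclideanSpace.single i 1) (dirDeriv v u) x ^ 2) ≤
        ENNReal.ofReal ((4 * C₀ * ∫ x, |lap N η x|) * ε) := by
  have hcont : Continuous (dirDeriv v u) :=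
    (h.2.1.continuous_fderiv (by simp)).clm_apply continuous_const
  set B : ℕ → Set 𝔼 := fun n =>
    A ∩ {x | 2 * (1 / ((n : ℝ) + 1)) ≤ |dirDeriv v u x| ∧ |dirDeriv v u x| ≤ ε} with hB
  set Z : Set 𝔼 := {x | dirDeriv v u x = 0} with hZ
  have hsub : A ∩ {x | |dirDeriv v u x| ≤ ε} ⊆ (⋃ n, B n) ∪ Z := by
    intro x hx
    by_cases h0 : dirDeriv v u x = 0
    · exact Or.inr h0
    · obtain ⟨n, hn⟩ := exists_nat_one_div_lt (half_pos (abs_pos.2 h0))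
      exact Or.inl (mem_iUnion.2 ⟨n, hx.1, by linarith, hx.2⟩)
  have hmono : Monotone B := by
    intro m n hmn x hx
    refine ⟨hx.1, le_trans ?_ hx.2.1, hx.2.2⟩
    exact mul_le_mul_of_nonneg_left (Nat.one_div_le_one_div hmn) zero_le_two
  have hzero : ∫⁻ x in Z, ENNReal.ofReal
      (∑ i, dirDeriv (EuclideanSpace.single i 1) (dirDeriv v u) x ^ 2) = 0 := by
    have hZm : MeasurableSet Z := (isClosed_eq hcont continuous_const).measurableSet
    rw [← lintegral_zero (μ := volume.restrict Z)]
    refine setLIntegral_congr_fun_ae hZm ?_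
    filter_upwards [ae_all_iff.2 fun i : Fin N =>
      ae_dirDeriv_eq_zero_of_eq_zero hcont (EuclideanSpace.single i 1)] with x hx hxZ
    simp [hx _ hxZ]
  calc _ ≤ ∫⁻ x in (⋃ n, B n) ∪ Z, ENNReal.ofReal
        (∑ i, dirDeriv (EuclideanSpace.single i 1) (dirDeriv v u) x ^ 2) := lintegral_mono_set hsub
    _ ≤ _ := lintegral_union_le _ _ _
    _ = ⨆ n, ∫⁻ x in B n, ENNReal.ofReal
        (∑ i, dirDeriv (EuclideanSpace.single i 1) (dirDeriv v u) x ^ 2) := by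
      rw [hzero, add_zero, setLIntegral_iUnion_of_directed _ hmono.directed_le]
    _ ≤ _ := iSup_le fun n =>
      h.setLIntegral_energy_le hN hη hη0 hηR hR hA hηA hC₀ hε (by positivity)

theorem exists_volume_small_gradient_le (hN : 0 < N) (hM : 0 < M) :
    ∃ C, 0 < C ∧ ∀ (Ω : Set 𝔼) (u : 𝔼 → ℝ), MemP N 1 0 M Ω u → ∀ ε, 0 < ε →
      volume {x | x ∈ Ω ∩ ball 0 (5 / 8) ∧ ∀ v, |dirDeriv v u x| ≤ ε * ‖v‖} ≤
        ENNReal.ofReal (C * ε) := by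
  obtain ⟨C₀, hC₀, hgrad⟩ := exists_gradient_bound hN hM
  let η : ContDiffBump (0 : 𝔼) := ⟨5 / 8, 11 / 16, by norm_num, by norm_num⟩
  obtain ⟨K, hK⟩ : ∃ K, K = 4 * C₀ * ∫ x, |lap N η x| := ⟨_, rfl⟩
  have hN' : (0 : ℝ) < N := by exact_mod_cast hN
  have hK0 : 0 ≤ K := by
    rw [hK]
    exact mul_nonneg (by positivity) (integral_nonneg fun _ => abs_nonneg _)
  refine ⟨N * (N * (K + 1)), by positivity, fun Ω u h ε hε => ?_⟩
  have hcont : ∀ v, Continuous (dirDeriv v u) := fun v =>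
    (h.2.1.continuous_fderiv (by simp)).clm_apply continuous_const
  set S : Set 𝔼 := {x | x ∈ Ω ∩ ball 0 (5 / 8) ∧ ∀ v, |dirDeriv v u x| ≤ ε * ‖v‖} with hS
  have hSm : MeasurableSet S := by
    have hcl : IsClosed {x | ∀ v, |dirDeriv v u x| ≤ ε * ‖v‖} := by
      rw [ofPred_forall]
      exact isClosed_iInter fun v => isClosed_le (hcont v).abs continuous_const
    exact (h.1.inter isOpen_ball).measurableSet.inter hcl.measurableSet
  have hj : ∀ j : Fin N, ∫⁻ x in S, ENNReal.ofReal (∑ i, dirDeriv (EuclideanSpace.single i 1)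
      (dirDeriv (EuclideanSpace.single j 1) u) x ^ 2) ≤ ENNReal.ofReal ((K + 1) * ε) := by
    intro j
    refine (lintegral_mono_set (t := ball 0 (5 / 8) ∩
      {x | |dirDeriv (EuclideanSpace.single j 1) u x| ≤ ε}) fun x hx => ⟨hx.1.2, ?_⟩).trans
      ((h.setLIntegral_energy_le_of_abs_le hN η.contDiff (fun _ => η.nonneg)
        η.tsupport_eq.subset (by norm_num) measurableSet_ball
        (fun x hx => η.one_of_mem_closedBall (ball_subset_closedBall hx)) (C₀ := C₀)
        (fun x hx => ?_) hε).trans (ENNReal.ofReal_le_ofReal ?_))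
    · simpa using hx.2 (EuclideanSpace.single j 1)
    · have hx' : ‖x‖ ≤ 11 / 16 := mem_closedBall_zero_iff.1 hx
      simpa using hgrad Ω u h x (by linarith) (EuclideanSpace.single j 1)
    · rw [← hK]
      exact mul_le_mul_of_nonneg_right (by linarith) hε.le
  have hmeas : ∀ j : Fin N, Measurable fun x => ENNReal.ofReal
      (∑ i, dirDeriv (EuclideanSpace.single i 1)
        (dirDeriv (EuclideanSpace.single j 1) u) x ^ 2) := fun j =>
    (Finset.measurable_sum _ fun i _ => (measurable_fderiv_apply_const ℝ
      (dirDeriv (EuclideanSpace.single j 1) u) (EuclideanSpace.single i 1)).pow_const 2).ennreal_ofReal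
  have key : ENNReal.ofReal (N : ℝ)⁻¹ * volume S ≤ ENNReal.ofReal (N * ((K + 1) * ε)) := by
    calc ENNReal.ofReal (N : ℝ)⁻¹ * volume S = ∫⁻ _ in S, ENNReal.ofReal (N : ℝ)⁻¹ := by
          rw [setLIntegral_const]
      _ ≤ ∫⁻ x in S, ∑ j : Fin N, ENNReal.ofReal (∑ i, dirDeriv (EuclideanSpace.single i 1)
            (dirDeriv (EuclideanSpace.single j 1) u) x ^ 2) := by
          refine setLIntegral_mono' hSm fun x hx => ?_
          rw [← ENNReal.ofReal_sum_of_nonneg fun j _ => Finset.sum_nonneg fun i _ => sq_nonneg _]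
          exact ENNReal.ofReal_le_ofReal (h.inv_le_sum_hess_sq hN hx.1.1
            (ball_subset_ball (by norm_num) hx.1.2))
      _ = ∑ j : Fin N, ∫⁻ x in S, ENNReal.ofReal (∑ i, dirDeriv (EuclideanSpace.single i 1)
            (dirDeriv (EuclideanSpace.single j 1) u) x ^ 2) :=
          lintegral_finsetSum _ fun j _ => hmeas j
      _ ≤ ∑ _j : Fin N, ENNReal.ofReal ((K + 1) * ε) := Finset.sum_le_sum fun j _ => hj j
      _ = _ := by
          rw [Finset.sum_const, Finset.card_univ, Fintype.card_fin, nsmul_eq_mul,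
            ENNReal.ofReal_mul hN'.le, ENNReal.ofReal_natCast]
  calc volume S = ENNReal.ofReal N * (ENNReal.ofReal (N : ℝ)⁻¹ * volume S) := by
        rw [← mul_assoc, ← ENNReal.ofReal_mul hN'.le, mul_inv_cancel₀ hN'.ne', ENNReal.ofReal_one,
          one_mul]
    _ ≤ ENNReal.ofReal N * ENNReal.ofReal (N * ((K + 1) * ε)) := by gcongr
    _ = _ := by
        rw [← ENNReal.ofReal_mul hN'.le]
        congr 1
        ring

end SmallGradient

theorem exists_finset_separated_cover {X : Type*} [PseudoMetricSpace X] {A : Set X} {δ : ℝ}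
    (hδ : 0 < δ) {n : ℕ} (hn : ∀ t : Finset X, (t : Set X) ⊆ A →
      (t : Set X).Pairwise (fun x y => δ ≤ dist x y) → t.card ≤ n) :
    ∃ t : Finset X, (t : Set X) ⊆ A ∧ (t : Set X).Pairwise (fun x y => δ ≤ dist x y) ∧
      A ⊆ ⋃ z ∈ t, ball z δ := by
  classical
  set P : ℕ → Prop := fun k => ∃ t : Finset X, (t : Set X) ⊆ A ∧
    (t : Set X).Pairwise (fun x y => δ ≤ dist x y) ∧ t.card = k with hP
  have h0 : P 0 := ⟨∅, by simp, by simp, rfl⟩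
  obtain ⟨t, htA, hts, htc⟩ := Nat.findGreatest_spec (P := P) (Nat.zero_le n) h0
  refine ⟨t, htA, hts, fun x hx => ?_⟩
  by_contra hxt
  have hfar : ∀ z ∈ t, δ ≤ dist x z := by
    intro z hz
    by_contra! hlt
    exact hxt (mem_biUnion hz hlt)
  have hxt' : x ∉ t := fun hxt' => absurd (hfar x hxt') (by simpa using hδ)
  have hsub : ((insert x t : Finset X) : Set X) ⊆ A := by
    rw [Finset.coe_insert]
    exact insert_subset hx htA
  have hsep : ((insert x t : Finset X) : Set X).Pairwise (fun x y => δ ≤ dist x y) := by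
    rw [Finset.coe_insert]
    exact hts.insert fun z hz _ => ⟨hfar z hz, by rw [dist_comm]; exact hfar z hz⟩
  have hcard := Finset.card_insert_of_notMem hxt'
  have := Nat.le_findGreatest (hn _ hsub hsep) (show P _ from ⟨_, hsub, hsep, rfl⟩)
  omega

section FreeBoundary

variable {N : ℕ}

local notation "𝔼" => EuclideanSpace ℝ (Fin N)

variable {M : ℝ}

theorem volume_ball_eq (x : 𝔼) {r : ℝ} (hr : 0 < r) :
    volume (ball x r) = ENNReal.ofReal (r ^ N * volume.real (ball (0 : 𝔼) 1)) := by
  rw [Measure.addHaar_ball_of_pos _ _ hr, ENNReal.ofReal_mul (by positivity),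
    ofReal_measureReal measure_ball_lt_top.ne, finrank_euclideanSpace, Fintype.card_fin]

theorem exists_finset_cover_frontier (hN : 0 < N) (hM : 0 < M) :
    ∃ C, 0 < C ∧ ∀ (Ω : Set 𝔼) (u : 𝔼 → ℝ), MemP N 1 0 M Ω u → ∀ ε, 0 < ε → ε ≤ 1 / 16 →
      ∃ t : Finset 𝔼, (t.card : ℝ) * ε ^ N ≤ C * ε ∧
        frontier Ω ∩ closedBall 0 (9 / 16) ⊆ ⋃ z ∈ t, ball z (2 * ε) := by
  obtain ⟨c, C₁, hc, -, hC₁, hball⟩ := exists_interior_ball hN hM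
  obtain ⟨C₂, hC₂, hvol⟩ := exists_volume_small_gradient_le hN hM
  obtain ⟨V, hV⟩ : ∃ V, V = volume.real (ball (0 : 𝔼) 1) := ⟨_, rfl⟩
  have hV0 : 0 < V := by
    rw [hV, measureReal_def]
    exact ENNReal.toReal_pos (measure_ball_pos _ _ one_pos).ne' measure_ball_lt_top.ne
  refine ⟨C₂ * C₁ / (c ^ N * V), by positivity, fun Ω u h ε hε hε1 => ?_⟩
  have hcard : ∀ t : Finset 𝔼, (t : Set 𝔼) ⊆ frontier Ω ∩ closedBall 0 (9 / 16) →
      (t : Set 𝔼).Pairwise (fun x y => 2 * ε ≤ dist x y) →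
      (t.card : ℝ) * ε ^ N ≤ C₂ * C₁ / (c ^ N * V) * ε := by
    intro t ht hsep
    have hnorm : ∀ z ∈ t, ‖z‖ ≤ 9 / 16 := fun z hz => mem_closedBall_zero_iff.1 (ht hz).2
    have hz : ∀ z ∈ t, (∃ y, ball y (c * ε) ⊆ Ω ∩ ball z ε) ∧
        ∀ x ∈ ball z ε, ∀ v, |dirDeriv v u x| ≤ C₁ * ε * ‖v‖ := fun z hz =>
      hball Ω u h z (ht hz).1 (by linarith [hnorm z hz]) ε hε hε1
    choose! y hy using fun z hz' => (hz z hz').1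
    have hdisj : (t : Set 𝔼).PairwiseDisjoint fun z => ball (y z) (c * ε) := by
      intro z hz z' hz' hne
      refine (ball_disjoint_ball ?_ : Disjoint (ball z ε) (ball z' ε)).mono
        ((hy z hz).trans inter_subset_right) ((hy z' hz').trans inter_subset_right)
      linarith [hsep hz hz' hne]
    have hsub : (⋃ z ∈ t, ball (y z) (c * ε)) ⊆ {x | x ∈ Ω ∩ ball 0 (5 / 8) ∧
        ∀ v, |dirDeriv v u x| ≤ (C₁ * ε) * ‖v‖} := by
      refine iUnion₂_subset fun z hzt x hx => ?_
      have hx' := hy z hzt hx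
      refine ⟨⟨hx'.1, ?_⟩, (hz z hzt).2 x hx'.2⟩
      rw [mem_ball_zero_iff]
      have h1 : ‖x - z‖ < ε := mem_ball_iff_norm.1 hx'.2
      linarith [norm_sub_norm_le x z, hnorm z hzt]
    have h1 := (measure_mono hsub).trans (hvol Ω u h (C₁ * ε) (by positivity))
    rw [measure_biUnion_finset hdisj fun z _ => measurableSet_ball,
      Finset.sum_congr rfl fun z _ => volume_ball_eq (y z) (by positivity : 0 < c * ε),
      Finset.sum_const, nsmul_eq_mul, ← ENNReal.ofReal_natCast,
      ← ENNReal.ofReal_mul (Nat.cast_nonneg _),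
      ENNReal.ofReal_le_ofReal_iff (by positivity), ← hV, mul_pow] at h1
    rw [div_mul_eq_mul_div, le_div_iff₀ (by positivity)]
    linarith
  obtain ⟨t, htA, hsep, hcov⟩ := exists_finset_separated_cover (by positivity : 0 < 2 * ε)
    (n := ⌊C₂ * C₁ / (c ^ N * V) * ε / ε ^ N⌋₊) fun t htA hsep => by
      refine Nat.le_floor ?_
      rw [le_div_iff₀ (by positivity)]
      exact hcard t htA hsep
  exact ⟨t, hcard t htA hsep, hcov⟩

theorem exists_volume_infDist_frontier_lt_le (hN : 0 < N) (hM : 0 < M) :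
    ∃ C, 0 < C ∧ ∀ (Ω : Set 𝔼) (u : 𝔼 → ℝ), MemP N 1 0 M Ω u → ∀ ε, 0 < ε →
      volume {x | x ∈ ball (0 : 𝔼) (1 / 2) ∧ infDist x (frontier Ω) < ε} ≤
        ENNReal.ofReal (C * ε) := by
  obtain ⟨C, hC, hcov⟩ := exists_finset_cover_frontier hN hM
  obtain ⟨V, hV⟩ : ∃ V, V = volume.real (ball (0 : 𝔼) 1) := ⟨_, rfl⟩
  have hV0 : 0 ≤ V := hV ▸ measureReal_nonneg
  refine ⟨3 ^ N * V * C + 16 * V + 1, by positivity, fun Ω u h ε hε => ?_⟩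
  rcases le_or_gt ε (1 / 16) with hε1 | hε1
  · obtain ⟨t, ht, htc⟩ := hcov Ω u h ε hε hε1
    have hsub : {x | x ∈ ball (0 : 𝔼) (1 / 2) ∧ infDist x (frontier Ω) < ε} ⊆
        ⋃ z ∈ t, ball z (3 * ε) := by
      rintro x ⟨hx, hxd⟩
      obtain ⟨z, hz, hxz⟩ := (infDist_lt_iff ⟨0, h.2.2.2.2.2⟩).1 hxd
      have hz' : z ∈ closedBall (0 : 𝔼) (9 / 16) := by
        rw [mem_closedBall]
        linarith [dist_triangle_left z 0 x, mem_ball.1 hx]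
      obtain ⟨w, hw, hzw⟩ := mem_iUnion₂.1 (htc ⟨hz, hz'⟩)
      refine mem_biUnion hw ?_
      rw [mem_ball] at hzw ⊢
      linarith [dist_triangle x z w]
    calc _ ≤ volume (⋃ z ∈ t, ball z (3 * ε)) := measure_mono hsub
      _ ≤ ∑ z ∈ t, volume (ball z (3 * ε)) := measure_biUnion_finset_le _ _
      _ = ENNReal.ofReal (t.card * ((3 * ε) ^ N * V)) := by
          rw [Finset.sum_congr rfl fun z _ => volume_ball_eq z (by positivity : 0 < 3 * ε),
            Finset.sum_const, nsmul_eq_mul, ← ENNReal.ofReal_natCast,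
            ← ENNReal.ofReal_mul (Nat.cast_nonneg _), hV]
      _ ≤ _ := by
          refine ENNReal.ofReal_le_ofReal ?_
          have h1 := mul_le_mul_of_nonneg_left ht (by positivity : 0 ≤ 3 ^ N * V)
          rw [mul_pow]
          nlinarith [mul_nonneg hV0 hε.le]
  · calc _ ≤ volume (ball (0 : 𝔼) 1) :=
          measure_mono fun x hx => ball_subset_ball (by norm_num) hx.1
      _ = ENNReal.ofReal V := by rw [hV, ofReal_measureReal measure_ball_lt_top.ne]
      _ ≤ _ := by
          refine ENNReal.ofReal_le_ofReal ?_
          have h1 : 0 ≤ 3 ^ N * V * C * ε := by positivity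
          nlinarith [mul_le_mul_of_nonneg_left hε1.le hV0]

theorem exists_hausdorffMeasure_frontier_le (hN : 0 < N) (hM : 0 < M) :
    ∃ C, 0 < C ∧ ∀ (Ω : Set 𝔼) (u : 𝔼 → ℝ), MemP N 1 0 M Ω u →
      μH[(N : ℝ) - 1] (frontier Ω ∩ ball (0 : 𝔼) (1 / 2)) ≤ ENNReal.ofReal C := by
  obtain ⟨C, hC, hcov⟩ := exists_finset_cover_frontier hN hM
  refine ⟨4 ^ N * C, by positivity, fun Ω u h => ?_⟩
  set ε : ℕ → ℝ := fun n => 1 / 16 * (1 / ((n : ℝ) + 1)) with hεdef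
  have hε : ∀ n, 0 < ε n := fun n => by positivity
  have hε1 : ∀ n, ε n ≤ 1 / 16 := fun n => by
    have : 1 / ((n : ℝ) + 1) ≤ 1 := by
      rw [div_le_one (by positivity)]
      linarith [n.cast_nonneg (α := ℝ)]
    simp only [hεdef]
    linarith
  choose t ht htc using fun n => hcov Ω u h (ε n) (hε n) (hε1 n)
  have hdiam : ∀ n (z : t n), ediam (ball (z : 𝔼) (2 * ε n)) ≤ ENNReal.ofReal (4 * ε n) := by
    intro n z
    refine ediam_le_of_forall_dist_le fun x hx y hy => ?_
    linarith [dist_triangle_right x y (z : 𝔼), mem_ball.1 hx, mem_ball.1 hy]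
  have hlim : Tendsto (fun n => ENNReal.ofReal (4 * ε n)) atTop (𝓝 0) := by
    have h1 := (tendsto_one_div_add_atTop_nhds_zero_nat (𝕜 := ℝ)).const_mul (1 / 16)
    have h2 := ENNReal.tendsto_ofReal (h1.const_mul 4)
    rw [mul_zero, mul_zero, ENNReal.ofReal_zero] at h2
    exact h2
  refine (Measure.hausdorffMeasure_le_liminf_sum ((N : ℝ) - 1) _ _ hlim
    (fun n (z : t n) => ball (z : 𝔼) (2 * ε n)) (Eventually.of_forall hdiam)
    (Eventually.of_forall fun n x hx => ?_)).trans ?_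
  · obtain ⟨z, hz, hxz⟩ := mem_iUnion₂.1 (htc n ⟨hx.1, closedBall_subset_closedBall (by norm_num)
      (ball_subset_closedBall hx.2)⟩)
    exact mem_iUnion.2 ⟨⟨z, hz⟩, hxz⟩
  · refine liminf_le_of_frequently_le' (Eventually.of_forall fun n => ?_).frequently
    have hN1 : (0 : ℝ) ≤ N - 1 := by
      have : (1 : ℝ) ≤ N := by exact_mod_cast hN
      linarith
    have hpos : 0 < 4 * ε n := by linarith [hε n]
    calc ∑ z : t n, ediam (ball (z : 𝔼) (2 * ε n)) ^ ((N : ℝ) - 1)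
        ≤ ∑ _z : t n, ENNReal.ofReal ((4 * ε n) ^ ((N : ℝ) - 1)) :=
          Finset.sum_le_sum fun z _ => by
            rw [← ENNReal.ofReal_rpow_of_pos hpos]
            exact ENNReal.rpow_le_rpow (hdiam n z) hN1
      _ = ENNReal.ofReal ((t n).card * ((4 * ε n) ^ N / (4 * ε n))) := by
          rw [Finset.sum_const, Finset.card_univ, Fintype.card_coe, nsmul_eq_mul,
            ← ENNReal.ofReal_natCast, ← ENNReal.ofReal_mul (Nat.cast_nonneg _),
            Real.rpow_sub_one hpos.ne', Real.rpow_natCast]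
      _ ≤ _ := by
          refine ENNReal.ofReal_le_ofReal ?_
          rw [mul_div_assoc', div_le_iff₀ hpos, mul_pow]
          have h1 := mul_le_mul_of_nonneg_left (ht n) (by positivity : (0 : ℝ) ≤ 4 ^ N)
          have h2 : 0 ≤ 4 ^ N * C * ε n := by have := hε n; positivity
          linarith

end FreeBoundary

/-- measure estimates near the free boundary, and local finiteness of the
`(N−1)`-Hausdorff measure of the free boundary. -/
theorem free_boundary_measure_estimates (N : ℕ) (hN : 2 ≤ N) (M : ℝ) (hM : 0 < M) :
    ∃ C : ℝ, 0 < C ∧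
      ∀ (Ω : Set (EuclideanSpace ℝ (Fin N))) (u : EuclideanSpace ℝ (Fin N) → ℝ),
        MemP N 1 0 M Ω u →
          ∀ ε : ℝ, 0 < ε →
            volume {x | x ∈ Ω ∩ ball (0 : EuclideanSpace ℝ (Fin N)) (1 / 2) ∧
                ‖gradient u x‖ < ε} ≤ ENNReal.ofReal (C * ε) ∧
            volume {x | x ∈ ball (0 : EuclideanSpace ℝ (Fin N)) (1 / 2) ∧
                Metric.infDist x (frontier Ω) < ε} ≤ ENNReal.ofReal (C * ε) ∧
            μH[(N : ℝ) - 1] (frontier Ω ∩ ball (0 : EuclideanSpace ℝ (Fin N)) (1 / 2)) ≤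
              ENNReal.ofReal C := by
  have hN0 : 0 < N := by omega
  obtain ⟨C₁, hC₁, h₁⟩ := exists_volume_small_gradient_le hN0 hM
  obtain ⟨C₂, hC₂, h₂⟩ := exists_volume_infDist_frontier_lt_le hN0 hM
  obtain ⟨C₃, hC₃, h₃⟩ := exists_hausdorffMeasure_frontier_le hN0 hM
  refine ⟨C₁ + C₂ + C₃, by positivity, fun Ω u h ε hε => ⟨?_, ?_, ?_⟩⟩
  · refine (measure_mono fun x hx => ?_).trans ((h₁ Ω u h ε hε).trans
      (ENNReal.ofReal_le_ofReal (mul_le_mul_of_nonneg_right (by linarith) hε.le)))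
    refine ⟨⟨hx.1.1, ball_subset_ball (by norm_num) hx.1.2⟩, fun v => ?_⟩
    have hg : ‖fderiv ℝ u x‖ < ε := by simpa [gradient] using hx.2
    exact ((fderiv ℝ u x).le_opNorm v).trans
      (mul_le_mul_of_nonneg_right hg.le (norm_nonneg v))
  · exact (h₂ Ω u h ε hε).trans
      (ENNReal.ofReal_le_ofReal (mul_le_mul_of_nonneg_right (by linarith) hε.le))
  · exact (h₃ Ω u h).trans (ENNReal.ofReal_le_ofReal (by linarith))
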